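/- Non-constructivity of the n-consistency incompleteness theorem: fix n ≥ 3. There is no partial function f recursive in the oracle ∅⁽ⁿ⁾ (the n-th Turing jump of the empty set) such that whenever m is the Gödel code of a Σ_{n+1}-formula Ψ(x) for which the theory T_Ψ = {α : ℕ ⊨ Ψ(⌜α⌝)} is an n-consistent extension of Robinson arithmetic Q, f(m) is defined and is the Gödel code of a Π_{n+1}-sentence independent of T_Ψ (i.e., neither provable nor refutable from T_Ψ). -/

import Mathlib

/-!
Formalization of results from "Gödel–Rosser's Incompleteness Theorems for
non-RE Theories" (Salehi & Seraji).

We work in the first-order language of arithmetic `{0, S, +, ×, ≤}` with the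
standard model `ℕ`.  Provability `T ⊢ φ` is rendered as the semantic
consequence `T ⊨ᵇ φ` of Mathlib's model theory library, which by the Gödel
completeness theorem coincides with provability in first-order logic.
-/

open FirstOrder Language BoundedFormula

namespace GRNonRE

/-- Function symbols of arithmetic: `0`, `S`, `+`, `×`. -/
inductive ArithFunc : ℕ → Type
  | zero : ArithFunc 0
  | succ : ArithFunc 1
  | add  : ArithFunc 2
  | mul  : ArithFunc 2

/-- The relation symbol `≤`. -/
inductive ArithRel : ℕ → Type
  | le : ArithRel 2

/-- The first-order language of arithmetic `{0, S, +, ×, ≤}`. -/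
def LA : FirstOrder.Language := ⟨ArithFunc, ArithRel⟩

/-- The standard model `ℕ`. -/
instance : LA.Structure ℕ where
  funMap {_} f := match f with
    | ArithFunc.zero => fun _ => 0
    | ArithFunc.succ => fun v => v 0 + 1
    | ArithFunc.add  => fun v => v 0 + v 1
    | ArithFunc.mul  => fun v => v 0 * v 1
  RelMap {_} r := match r with
    | ArithRel.le => fun v => v 0 ≤ v 1

def zeroT {α : Type} : LA.Term α := Term.func ArithFunc.zero ![]
def succT {α : Type} (t : LA.Term α) : LA.Term α := Term.func ArithFunc.succ ![t]
def addT {α : Type} (t s : LA.Term α) : LA.Term α := Term.func ArithFunc.add ![t, s]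
def mulT {α : Type} (t s : LA.Term α) : LA.Term α := Term.func ArithFunc.mul ![t, s]

/-- The atomic formula `t ≤ s`. -/
def leF {α : Type} {n : ℕ} (t s : LA.Term (α ⊕ Fin n)) : LA.BoundedFormula α n :=
  BoundedFormula.rel ArithRel.le ![t, s]

/-- The numeral `m̄ = S (S ⋯ (S 0))` representing `m : ℕ`. -/
def numeral : ℕ → LA.Term Empty
  | 0 => zeroT
  | n + 1 => succT (numeral n)

instance : Encodable (Σ n, LA.Functions n) :=
  ⟨fun f => match f with
    | ⟨_, ArithFunc.zero⟩ => 0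
    | ⟨_, ArithFunc.succ⟩ => 1
    | ⟨_, ArithFunc.add⟩ => 2
    | ⟨_, ArithFunc.mul⟩ => 3,
   fun n => match n with
    | 0 => some ⟨0, ArithFunc.zero⟩
    | 1 => some ⟨1, ArithFunc.succ⟩
    | 2 => some ⟨2, ArithFunc.add⟩
    | 3 => some ⟨2, ArithFunc.mul⟩
    | _ => none,
   by rintro ⟨n, f⟩; cases f <;> rfl⟩

instance : Encodable (Σ n, LA.Relations n) :=
  ⟨fun _ => 0,
   fun n => match n with
    | 0 => some ⟨2, ArithRel.le⟩
    | _ => none,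
   by rintro ⟨n, r⟩; cases r; rfl⟩

/-- A standard Gödel numbering of formulas, obtained from Mathlib's structural
encoding of bounded formulas as lists of symbols. -/
def godel {k : ℕ} (φ : LA.BoundedFormula Empty k) : ℕ :=
  Encodable.encode φ.listEncode

/-- Lift a term in context `k` to context `k + 1`. -/
def liftT {k : ℕ} (t : LA.Term (Empty ⊕ Fin k)) : LA.Term (Empty ⊕ Fin (k + 1)) :=
  t.relabel (Sum.map id Fin.castSucc)

/-- The class `Σ₀ = Π₀ = Δ₀` of bounded formulas: built from atomic formulas by
Boolean connectives (`⊥` and `⟹`, from which `∼`, `⊓`, `⊔` are definable) and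
bounded universal quantification `∀ x ≤ t, φ` (bounded existential
quantification `∃ x ≤ t, φ` is expressible as `∼ ∀ x ≤ t, ∼φ`). -/
inductive Delta0 : ∀ {k : ℕ}, LA.BoundedFormula Empty k → Prop
  | falsum {k : ℕ} : Delta0 (⊥ : LA.BoundedFormula Empty k)
  | equal {k : ℕ} (t₁ t₂ : LA.Term (Empty ⊕ Fin k)) : Delta0 (t₁ =' t₂)
  | le {k : ℕ} (t₁ t₂ : LA.Term (Empty ⊕ Fin k)) : Delta0 (leF t₁ t₂)
  | imp {k : ℕ} {φ ψ : LA.BoundedFormula Empty k} :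
      Delta0 φ → Delta0 ψ → Delta0 (φ ⟹ ψ)
  | bdall {k : ℕ} (t : LA.Term (Empty ⊕ Fin k)) {φ : LA.BoundedFormula Empty (k + 1)} :
      Delta0 φ → Delta0 ((leF (&(Fin.last k)) (liftT t) ⟹ φ).all)

mutual
  /-- The classes `Σₙ` of the arithmetical hierarchy: `Σ₀` is the class of
  bounded formulas, and `Σ_{n+1}` contains `Πₙ` and is closed under `⊓`, `⊔`,
  existential quantification and bounded universal quantification. -/
  inductive IsSigma : ℕ → ∀ {k : ℕ}, LA.BoundedFormula Empty k → Prop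
    | ofDelta0 {k : ℕ} {φ : LA.BoundedFormula Empty k} : Delta0 φ → IsSigma 0 φ
    | ofPi {n k : ℕ} {φ : LA.BoundedFormula Empty k} :
        IsPi n φ → IsSigma (n + 1) φ
    | ex {n k : ℕ} {φ : LA.BoundedFormula Empty (k + 1)} :
        IsSigma (n + 1) φ → IsSigma (n + 1) φ.ex
    | inf {n k : ℕ} {φ ψ : LA.BoundedFormula Empty k} :
        IsSigma (n + 1) φ → IsSigma (n + 1) ψ → IsSigma (n + 1) (φ ⊓ ψ)
    | sup {n k : ℕ} {φ ψ : LA.BoundedFormula Empty k} :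
        IsSigma (n + 1) φ → IsSigma (n + 1) ψ → IsSigma (n + 1) (φ ⊔ ψ)
    | bdall {n k : ℕ} (t : LA.Term (Empty ⊕ Fin k))
        {φ : LA.BoundedFormula Empty (k + 1)} :
        IsSigma (n + 1) φ → IsSigma (n + 1) ((leF (&(Fin.last k)) (liftT t) ⟹ φ).all)

  /-- The classes `Πₙ` of the arithmetical hierarchy: `Π₀` is the class of
  bounded formulas, and `Π_{n+1}` contains `Σₙ` and is closed under `⊓`, `⊔`,
  universal quantification and bounded existential quantification. -/
  inductive IsPi : ℕ → ∀ {k : ℕ}, LA.BoundedFormula Empty k → Prop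
    | ofDelta0 {k : ℕ} {φ : LA.BoundedFormula Empty k} : Delta0 φ → IsPi 0 φ
    | ofSigma {n k : ℕ} {φ : LA.BoundedFormula Empty k} :
        IsSigma n φ → IsPi (n + 1) φ
    | all {n k : ℕ} {φ : LA.BoundedFormula Empty (k + 1)} :
        IsPi (n + 1) φ → IsPi (n + 1) φ.all
    | inf {n k : ℕ} {φ ψ : LA.BoundedFormula Empty k} :
        IsPi (n + 1) φ → IsPi (n + 1) ψ → IsPi (n + 1) (φ ⊓ ψ)
    | sup {n k : ℕ} {φ ψ : LA.BoundedFormula Empty k} :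
        IsPi (n + 1) φ → IsPi (n + 1) ψ → IsPi (n + 1) (φ ⊔ ψ)
    | bdex {n k : ℕ} (t : LA.Term (Empty ⊕ Fin k))
        {φ : LA.BoundedFormula Empty (k + 1)} :
        IsPi (n + 1) φ → IsPi (n + 1) ((leF (&(Fin.last k)) (liftT t) ⊓ φ).ex)
end

/-- `T ⊢ φ`: by the Gödel completeness theorem, provability of the sentence `φ`
from the theory `T` coincides with the semantic consequence relation. -/
def Proves (T : LA.Theory) (φ : LA.Sentence) : Prop := T ⊨ᵇ φ

/-- Consistency of a theory. -/
def Consistent (T : LA.Theory) : Prop := ¬ Proves T ⊥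

/-- `ψ(m̄)`: the result of substituting the numeral `m̄` for the free variable
of a formula `ψ(x)` with one free variable. -/
def subst1 (ψ : LA.BoundedFormula Empty 1) (m : ℕ) : LA.Sentence :=
  ψ.toFormula.subst fun _ => numeral m

/-- `n`-consistency: there is no formula `ψ(x) ∈ Π_{n-1}` such that `T ⊢ ¬ψ(m̄)`
for every numeral `m̄` (`m ∈ ℕ`) and yet `T ⊢ ∃x ψ(x)`.
(`0`-consistency is ordinary consistency.) -/
def NCon : ℕ → LA.Theory → Prop
  | 0, T => Consistent T
  | n + 1, T => ¬ ∃ ψ : LA.BoundedFormula Empty 1, IsPi n ψ ∧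
      (∀ m : ℕ, Proves T (∼(subst1 ψ m))) ∧ Proves T ψ.ex

/-- The axioms of Robinson arithmetic `Q`:
`Sx ≠ 0`, `Sx = Sy → x = y`, `x ≠ 0 → ∃y x = Sy`, `x + 0 = x`,
`x + Sy = S(x + y)`, `x·0 = 0`, `x·Sy = x·y + x`, `x ≤ y ↔ ∃z z + x = y`. -/
def QTheory : LA.Theory :=
  { ∀' ∼(succT (&0) =' zeroT),
    ∀' ∀' ((succT (&0) =' succT (&1)) ⟹ (&0 =' &1)),
    ∀' (∼(&0 =' zeroT) ⟹ ∃' (&0 =' succT (&1))),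
    ∀' (addT (&0) zeroT =' &0),
    ∀' ∀' (addT (&0) (succT (&1)) =' succT (addT (&0) (&1))),
    ∀' (mulT (&0) zeroT =' zeroT),
    ∀' ∀' (mulT (&0) (succT (&1)) =' addT (mulT (&0) (&1)) (&0)),
    ((leF (&0) (&1) ⇔ ∃' (addT (&2) (&0) =' (&1)) : LA.BoundedFormula Empty 2)).alls }

/-- `T` is an extension of Robinson arithmetic `Q` (i.e. `T` proves `Q`). -/
def ExtendsQ (T : LA.Theory) : Prop := ∀ φ ∈ QTheory, Proves T φ

/-- `Πₙ-Th(ℕ)`: the set of `Πₙ`-sentences true in the standard model. -/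
def PiTh (n : ℕ) : LA.Theory := {φ | IsPi n φ ∧ ℕ ⊨ φ}

/-- Soundness: every theorem of `T` is true in `ℕ`. -/
def Sound (T : LA.Theory) : Prop := ∀ φ : LA.Sentence, Proves T φ → ℕ ⊨ φ

/-- `Σₙ`-soundness: every `Σₙ`-sentence provable in `T` is true in `ℕ`. -/
def SigmaSound (n : ℕ) (T : LA.Theory) : Prop :=
  ∀ φ : LA.Sentence, IsSigma n φ → Proves T φ → ℕ ⊨ φ

/-- A formula `Ψ(x)` with one free variable defines the set `A ⊆ ℕ` in `ℕ`. -/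
def Defines (Ψ : LA.BoundedFormula Empty 1) (A : Set ℕ) : Prop :=
  ∀ m : ℕ, m ∈ A ↔ Ψ.Realize (fun e => Empty.elim e) ![m]

/-- `A ⊆ ℕ` is definable in `ℕ` by a `Σₙ`-formula. -/
def SigmaDefinable (n : ℕ) (A : Set ℕ) : Prop := ∃ Ψ, IsSigma n Ψ ∧ Defines Ψ A

/-- `A ⊆ ℕ` is definable in `ℕ` by a `Πₙ`-formula. -/
def PiDefinable (n : ℕ) (A : Set ℕ) : Prop := ∃ Ψ, IsPi n Ψ ∧ Defines Ψ A

/-- The set of Gödel numbers of the axioms of `T`. -/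
def axiomCodes (T : LA.Theory) : Set ℕ := {m | ∃ φ ∈ T, godel φ = m}

/-- The set of Gödel numbers of the theorems of `T` (its deductive closure). -/
def theoremCodes (T : LA.Theory) : Set ℕ := {m | ∃ φ, Proves T φ ∧ godel φ = m}

/-- Relativized partial recursiveness: `RecursiveIn O f` means that the partial
function `f : ℕ →. ℕ` is computable by a Turing machine with an oracle for the
set `O ⊆ ℕ` (equivalently, it is generated from the basic functions together
with the characteristic function of `O` by pairing, composition, primitive
recursion and unbounded search). -/
inductive RecursiveIn (O : Set ℕ) : (ℕ →. ℕ) → Prop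
  | zero : RecursiveIn O (pure 0)
  | succ : RecursiveIn O Nat.succ
  | left : RecursiveIn O ↑fun n : ℕ => n.unpair.1
  | right : RecursiveIn O ↑fun n : ℕ => n.unpair.2
  | oracle : RecursiveIn O ↑fun n : ℕ => O.indicator (fun _ => 1) n
  | pair {f g} : RecursiveIn O f → RecursiveIn O g →
      RecursiveIn O fun n => Nat.pair <$> f n <*> g n
  | comp {f g} : RecursiveIn O f → RecursiveIn O g →
      RecursiveIn O fun n => g n >>= f
  | prec {f g} : RecursiveIn O f → RecursiveIn O g →
      RecursiveIn O (Nat.unpaired fun a n =>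
        n.rec (f a) fun y IH => do let i ← IH; g (Nat.pair a (Nat.pair y i)))
  | rfind {f} : RecursiveIn O f →
      RecursiveIn O fun a => Nat.rfind fun n => (fun m => m = 0) <$> f (Nat.pair a n)

/-- The set of Gödel numbers of true `Σₙ`-sentences.  This is a canonical
`Σₙ`-complete set, Turing-equivalent (for `n ≥ 1`) to the `n`-th Turing jump
`∅⁽ⁿ⁾` of the empty set; so a function is `∅⁽ⁿ⁾`-recursive exactly when it is
recursive in this set. -/
def SigmaTruth (n : ℕ) : Set ℕ :=
  {m | ∃ φ : LA.Sentence, IsSigma n φ ∧ godel φ = m ∧ ℕ ⊨ φ}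

/-- `T_Ψ`: the theory axiomatized by the sentences whose Gödel numbers satisfy
`Ψ` in `ℕ`. -/
def TheoryOf (Ψ : LA.BoundedFormula Empty 1) : LA.Theory :=
  {φ : LA.Sentence | Ψ.Realize (fun e => Empty.elim e) ![godel φ]}

section Primitive

variable {α β γ : Type} [Primcodable α] [Primcodable β] [Primcodable γ]

attribute [fun_prop] Primrec
attribute [fun_prop] Primrec.const Primrec.fst Primrec.snd Primrec.succ Primrec.encode
  Primrec.list_length Primrec.list_range

@[fun_prop]
theorem primrec_id : Primrec fun a : α => a := Primrec.id

@[fun_prop]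
theorem primrec_comp {f : β → γ} {g : α → β} (hf : Primrec f) (hg : Primrec g) :
    Primrec fun a => f (g a) := hf.comp hg

@[fun_prop]
theorem primrec_mk {f : α → β} {g : α → γ} (hf : Primrec f) (hg : Primrec g) :
    Primrec fun a => (f a, g a) := hf.pair hg

@[fun_prop]
theorem primrec_cons {f : α → β} {g : α → List β} (hf : Primrec f) (hg : Primrec g) :
    Primrec fun a => f a :: g a := Primrec.list_cons.comp hf hg

@[fun_prop]
theorem primrec_append {f g : α → List β} (hf : Primrec f) (hg : Primrec g) :
    Primrec fun a => f a ++ g a := Primrec.list_append.comp hf hg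

@[fun_prop]
theorem primrec_getD {f : α → List β} {g : α → ℕ} {d : β} (hf : Primrec f) (hg : Primrec g) :
    Primrec fun a => (f a).getD (g a) d := (Primrec.list_getD d).comp hf hg

@[fun_prop]
theorem primrec_drop {f : α → List β} {g : α → ℕ} (hf : Primrec f) (hg : Primrec g) :
    Primrec fun a => (f a).drop (g a) := Primrec.list_drop.comp hg hf

@[fun_prop]
theorem primrec_natPair {f g : α → ℕ} (hf : Primrec f) (hg : Primrec g) :
    Primrec fun a => Nat.pair (f a) (g a) := Primrec₂.natPair.comp hf hg

@[fun_prop]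
theorem primrec_unpair {f : α → ℕ} (hf : Primrec f) :
    Primrec fun a => Nat.unpair (f a) := Primrec.unpair.comp hf

@[fun_prop]
theorem primrec_add {f g : α → ℕ} (hf : Primrec f) (hg : Primrec g) :
    Primrec fun a => f a + g a := Primrec.nat_add.comp hf hg

@[fun_prop]
theorem primrec_mul {f g : α → ℕ} (hf : Primrec f) (hg : Primrec g) :
    Primrec fun a => f a * g a := Primrec.nat_mul.comp hf hg

@[fun_prop]
theorem primrec_div {f g : α → ℕ} (hf : Primrec f) (hg : Primrec g) :
    Primrec fun a => f a / g a := Primrec.nat_div.comp hf hg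

@[fun_prop]
theorem primrec_mod {f g : α → ℕ} (hf : Primrec f) (hg : Primrec g) :
    Primrec fun a => f a % g a := Primrec.nat_mod.comp hf hg

@[fun_prop]
theorem primrec_pow {f g : α → ℕ} (hf : Primrec f) (hg : Primrec g) :
    Primrec fun a => f a ^ g a :=
  ((Primrec₂.unpaired'.1 Nat.Primrec.pow).comp hf hg)

end Primitive

/-- The `Σₙ` level of the arithmetical hierarchy of predicates, over primitive recursive
predicates. -/
def SigmaPred : ℕ → ∀ {α : Type} [Primcodable α], (α → Prop) → Prop
  | 0, _, _, p => PrimrecPred p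
  | n + 1, α, _, p => ∃ q : α × ℕ → Prop, SigmaPred n q ∧ ∀ a, p a ↔ ∃ y, ¬ q (a, y)

namespace SigmaPred

variable {α β : Type} [Primcodable α] [Primcodable β] {n m : ℕ}

theorem of_iff {p q : α → Prop} (hp : SigmaPred n p) (h : ∀ a, q a ↔ p a) : SigmaPred n q :=
  (funext fun a => propext (h a) : q = p) ▸ hp

theorem comp {p : β → Prop} (hp : SigmaPred n p) {f : α → β} (hf : Primrec f) :
    SigmaPred n fun a => p (f a) := by
  induction n generalizing α β with
  | zero => exact PrimrecPred.comp hp hf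
  | succ n ih =>
    obtain ⟨q, hq, h⟩ := hp
    exact ⟨fun x => q (f x.1, x.2), ih hq (by fun_prop), fun a => h (f a)⟩

theorem not {p : α → Prop} (hp : SigmaPred n p) : SigmaPred (n + 1) fun a => ¬ p a :=
  ⟨fun x => p x.1, hp.comp Primrec.fst, fun a => by simp⟩

theorem succ {p : α → Prop} (hp : SigmaPred n p) : SigmaPred (n + 1) p := by
  induction n generalizing α with
  | zero => exact ⟨fun x => ¬ p x.1, PrimrecPred.not (PrimrecPred.comp hp Primrec.fst), by simp⟩
  | succ n ih =>
    obtain ⟨q, hq, h⟩ := hp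
    exact ⟨q, ih hq, h⟩

theorem mono {p : α → Prop} (hp : SigmaPred m p) (h : m ≤ n) : SigmaPred n p := by
  induction n, h using Nat.le_induction with
  | base => exact hp
  | succ n _ ih => exact ih.succ

theorem of_primrec {p : α → Prop} (hp : PrimrecPred p) : SigmaPred n p :=
  mono (m := 0) hp (Nat.zero_le n)

theorem not_of_lt {p : α → Prop} (hp : SigmaPred m p) (h : m < n) : SigmaPred n fun a => ¬ p a :=
  hp.not.mono h

theorem and_or (n : ℕ) : ∀ {α : Type} [Primcodable α] {p q : α → Prop},
    SigmaPred n p → SigmaPred n q →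
      SigmaPred n (fun a => p a ∧ q a) ∧ SigmaPred n (fun a => p a ∨ q a) := by
  induction n with
  | zero => exact fun hp hq => ⟨PrimrecPred.and hp hq, PrimrecPred.or hp hq⟩
  | succ n ih =>
    rintro α _ p q ⟨p', hp, h⟩ ⟨q', hq, h'⟩
    refine ⟨⟨fun x => p' (x.1, x.2.unpair.1) ∨ q' (x.1, x.2.unpair.2),
      (ih (hp.comp (by fun_prop)) (hq.comp (by fun_prop))).2, fun a => ?_⟩,
      ⟨fun x => p' x ∧ q' x, (ih hp hq).1, fun a => ?_⟩⟩
    · simp only [h, h', not_or]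
      constructor
      · rintro ⟨⟨y, hy⟩, z, hz⟩
        exact ⟨Nat.pair y z, by simpa using ⟨hy, hz⟩⟩
      · rintro ⟨y, hy, hz⟩
        exact ⟨⟨_, hy⟩, _, hz⟩
    · simp only [h, h', not_and_or, exists_or]

theorem and {p q : α → Prop} (hp : SigmaPred n p) (hq : SigmaPred n q) :
    SigmaPred n fun a => p a ∧ q a := (and_or n hp hq).1

theorem or {p q : α → Prop} (hp : SigmaPred n p) (hq : SigmaPred n q) :
    SigmaPred n fun a => p a ∨ q a := (and_or n hp hq).2

theorem ex [Inhabited β] {p : α → β → Prop} (hp : SigmaPred (n + 1) fun x : α × β => p x.1 x.2) :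
    SigmaPred (n + 1) fun a => ∃ b, p a b := by
  obtain ⟨q, hq, h⟩ := hp
  refine ⟨fun x => q ((x.1, (Encodable.decode x.2.unpair.1).getD default), x.2.unpair.2),
    hq.comp ?_, fun a => ?_⟩
  · have : Primrec fun k : ℕ => (Encodable.decode k : Option β).getD default :=
      Primrec.option_getD_default.comp Primrec.decode
    exact (Primrec.fst.pair (this.comp (by fun_prop))).pair (by fun_prop)
  · constructor
    · rintro ⟨b, hb⟩
      obtain ⟨y, hy⟩ := (h (a, b)).1 hb
      exact ⟨Nat.pair (Encodable.encode b) y, by simpa using hy⟩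
    · rintro ⟨y, hy⟩
      exact ⟨_, (h (a, _)).2 ⟨_, hy⟩⟩

theorem exists_forall_mem (n : ℕ) : ∀ {α β : Type} [Primcodable α] [Primcodable β] [Inhabited β]
    {f : α → List β} {p : α → β → Prop}, Primrec f → SigmaPred n (fun x : α × β => p x.1 x.2) →
      SigmaPred n (fun a => ∃ b ∈ f a, p a b) ∧ SigmaPred n (fun a => ∀ b ∈ f a, p a b) := by
  induction n with
  | zero =>
    intro α β _ _ _ f p hf hp
    have hp' : PrimrecRel fun (b : β) (a : α) => p a b :=
      PrimrecPred.comp (p := fun x : α × β => p x.1 x.2) hp (f := fun x : β × α => (x.2, x.1))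
        (by fun_prop)
    exact ⟨hp'.exists_mem_list.comp hf Primrec.id, hp'.forall_mem_list.comp hf Primrec.id⟩
  | succ n ih =>
    intro α β _ _ _ f p hf hp
    constructor
    · refine ex (p := fun a b => b ∈ f a ∧ p a b) (and (of_primrec ?_) hp)
      have : PrimrecRel fun (L : List β) (b : β) => ∃ b' ∈ L, b' = b :=
        PrimrecRel.exists_mem_list Primrec.eq
      exact (this.comp (hf.comp Primrec.fst) Primrec.snd).of_eq fun x => by simp
    · obtain ⟨q, hq, h⟩ := hp
      refine ⟨fun x => ∃ b ∈ f x.1, ∀ y ∈ List.range x.2, q ((x.1, b), y), ?_, fun a => ?_⟩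
      · refine (ih (by fun_prop) ?_).1
        exact (ih (f := fun x : (α × ℕ) × β => List.range x.1.2)
          (p := fun x y => q ((x.1.1, x.2), y)) (by fun_prop) (hq.comp (by fun_prop))).2
      · simp only [fun b => h (a, b), not_exists, not_and, not_forall, List.mem_range]
        constructor
        · classical
          intro H
          choose! g hg using H
          obtain ⟨N, hN⟩ := (f a).toFinset.image g |>.exists_nat_subset_range
          exact ⟨N, fun b hb => ⟨g b, by simpa using hN (Finset.mem_image_of_mem g (by simpa)),
            hg b hb⟩⟩
        · rintro ⟨N, H⟩ b hb
          obtain ⟨y, -, hy⟩ := H b hb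
          exact ⟨y, hy⟩

theorem exists_mem [Inhabited β] {f : α → List β} {p : α → β → Prop} (hf : Primrec f)
    (hp : SigmaPred n fun x : α × β => p x.1 x.2) : SigmaPred n fun a => ∃ b ∈ f a, p a b :=
  (exists_forall_mem n hf hp).1

theorem forall_mem [Inhabited β] {f : α → List β} {p : α → β → Prop} (hf : Primrec f)
    (hp : SigmaPred n fun x : α × β => p x.1 x.2) : SigmaPred n fun a => ∀ b ∈ f a, p a b :=
  (exists_forall_mem n hf hp).2

theorem forall_lt {f : α → ℕ} {p : α → ℕ → Prop} (hf : Primrec f)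
    (hp : SigmaPred n fun x : α × ℕ => p x.1 x.2) : SigmaPred n fun a => ∀ i < f a, p a i :=
  (forall_mem (f := fun a => List.range (f a)) (by fun_prop) hp).of_iff fun a => by simp

theorem eq {f g : α → β} (hf : Primrec f) (hg : Primrec g) : SigmaPred n fun a => f a = g a :=
  of_primrec (Primrec.eq.comp hf hg)

theorem lt {f g : α → ℕ} (hf : Primrec f) (hg : Primrec g) : SigmaPred n fun a => f a < g a :=
  of_primrec (Primrec.nat_lt.comp hf hg)

theorem mem [Inhabited β] {f : α → β} {g : α → List β} (hf : Primrec f) (hg : Primrec g) :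
    SigmaPred n fun a => f a ∈ g a :=
  (exists_mem (p := fun a b => f a = b) hg (eq (by fun_prop) (by fun_prop))).of_iff
    fun a => by simp

end SigmaPred

/-- The predicate generated by finitary rules: `step (D, a)` says that `a` follows from the finite
list `D` of premises. -/
inductive Generated {α : Type} (step : List α × α → Prop) : α → Prop
  | intro (D : List α) (a : α) : (∀ d ∈ D, Generated step d) → step (D, a) → Generated step a

theorem generated_iff {α : Type} [Inhabited α] {step : List α × α → Prop}
    (mono : ∀ D D' a, D ⊆ D' → step (D, a) → step (D', a)) (a : α) :
    Generated step a ↔ ∃ D : List α, a ∈ D ∧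
      ∀ i < D.length, step (D.drop (i + 1), D.getD i default) := by
  have key : ∀ D : List α, (∀ i < D.length, step (D.drop (i + 1), D.getD i default)) →
      ∀ d ∈ D, Generated step d := by
    intro D
    induction D with
    | nil => simp
    | cons x D ih =>
      intro h
      have hD : ∀ d ∈ D, Generated step d := ih fun i hi => by
        simpa using h (i + 1) (by simpa using hi)
      intro d hd
      rcases List.mem_cons.1 hd with rfl | hd
      · exact .intro D d hD (by simpa using h 0 (by simp))
      · exact hD d hd
  refine ⟨fun h => ?_, fun ⟨D, ha, h⟩ => key D h a ha⟩
  suffices H : ∃ D : List α, D.head? = some a ∧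
      ∀ i < D.length, step (D.drop (i + 1), D.getD i default) by
    obtain ⟨D, h1, h2⟩ := H
    exact ⟨D, List.mem_of_mem_head? h1, h2⟩
  induction h with
  | intro D a _ hs ih =>
    have : ∃ E : List α, D ⊆ E ∧ ∀ i < E.length, step (E.drop (i + 1), E.getD i default) := by
      clear hs
      induction D with
      | nil => exact ⟨[], by simp, by simp⟩
      | cons d D ihD =>
        obtain ⟨E, hE, hE'⟩ := ihD (fun d hd => by simp_all) (fun d hd => ih d (by simp [hd]))
        obtain ⟨F, hF, hF'⟩ := ih d (by simp)
        refine ⟨F ++ E, ?_, fun i hi => ?_⟩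
        · intro x hx
          rcases List.mem_cons.1 hx with rfl | hx
          · exact List.mem_append_left _ (List.mem_of_mem_head? hF)
          · exact List.mem_append_right _ (hE hx)
        · rcases lt_or_ge i F.length with h | h
          · rw [List.getD_append _ _ _ _ h]
            refine mono _ _ _ ?_ (hF' i h)
            rw [List.drop_append]
            exact List.subset_append_left _ _
          · rw [List.getD_append_right _ _ _ _ h, List.drop_append,
              List.drop_of_length_le (by omega), List.nil_append,
              show i + 1 - F.length = i - F.length + 1 by omega]
            exact hE' _ (by simp at hi; omega)
    obtain ⟨E, hE, hE'⟩ := this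
    refine ⟨a :: E, rfl, fun i hi => ?_⟩
    cases i with
    | zero => simpa using mono _ _ _ hE hs
    | succ i => simpa using hE' i (by simpa using hi)

theorem SigmaPred.generated {α : Type} [Primcodable α] [Inhabited α] {n : ℕ}
    {step : List α × α → Prop} (hstep : SigmaPred (n + 1) step)
    (mono : ∀ D D' a, D ⊆ D' → step (D, a) → step (D', a)) :
    SigmaPred (n + 1) (Generated step) := by
  refine SigmaPred.of_iff (ex (β := List α) (and (mem Primrec.fst Primrec.snd)
    (forall_lt (by fun_prop) ?_))) (generated_iff mono)
  exact hstep.comp (by fun_prop)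

theorem SigmaPred.of_generated {α : Type} [Primcodable α] [Inhabited α] {n : ℕ}
    {step : List α × α → Prop} {p : α → Prop} (hstep : SigmaPred (n + 1) step)
    (mono : ∀ D D' a, D ⊆ D' → step (D, a) → step (D', a))
    (sound : ∀ D a, (∀ d ∈ D, p d) → step (D, a) → p a)
    (complete : ∀ a, p a → Generated step a) :
    SigmaPred (n + 1) p :=
  (hstep.generated mono).of_iff fun a => ⟨complete a, fun h => by
    induction h with
    | intro D a _ hs ih => exact sound D a ih hs⟩

attribute [fun_prop] SigmaPred
attribute [fun_prop] SigmaPred.comp SigmaPred.and SigmaPred.or SigmaPred.ex SigmaPred.exists_mem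
  SigmaPred.forall_mem SigmaPred.forall_lt SigmaPred.eq SigmaPred.lt SigmaPred.mem

theorem mem_natRec_iff (a : Part ℕ) (g : ℕ → ℕ → Part ℕ) (n z : ℕ) :
    z ∈ (Nat.rec a (fun y IH => IH >>= fun i => g y i) n : Part ℕ) ↔
      ∃ L : List ℕ, L.getD 0 0 ∈ a ∧ (∀ i < n, L.getD (i + 1) 0 ∈ g i (L.getD i 0)) ∧
        L.getD n 0 = z := by
  have key : z ∈ (Nat.rec a (fun y IH => IH >>= fun i => g y i) n : Part ℕ) ↔
      ∃ s : ℕ → ℕ, s 0 ∈ a ∧ (∀ i < n, s (i + 1) ∈ g i (s i)) ∧ s n = z := by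
    induction n generalizing z with
    | zero => exact ⟨fun h => ⟨fun _ => z, h, by simp, rfl⟩, fun ⟨s, h, _, hz⟩ => hz ▸ h⟩
    | succ n ih =>
      change z ∈ ((Nat.rec a (fun y IH => IH >>= fun i => g y i) n : Part ℕ) >>= fun i => g n i) ↔ _
      refine Part.mem_bind_iff.trans ((exists_congr fun y => and_congr_left' (ih y)).trans ?_)
      constructor
      · rintro ⟨y, ⟨s, h0, hs, rfl⟩, hz⟩
        refine ⟨Function.update s (n + 1) z, by simpa, fun i hi => ?_, by simp⟩
        rcases Nat.lt_succ_iff_lt_or_eq.1 hi with h | rfl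
        · rw [Function.update_of_ne (by omega), Function.update_of_ne (by omega)]
          exact hs i h
        · rw [Function.update_self, Function.update_of_ne (by omega)]
          exact hz
      · rintro ⟨s, h0, hs, rfl⟩
        exact ⟨s n, ⟨s, h0, fun i hi => hs i (by omega), rfl⟩, hs n (by omega)⟩
  rw [key]
  constructor
  · rintro ⟨s, h0, hs, rfl⟩
    have hL : ∀ i ≤ n, ((List.range (n + 1)).map s).getD i 0 = s i := fun i hi => by
      rw [List.getD_eq_getElem _ _ (by simp; omega)]
      simp
    exact ⟨(List.range (n + 1)).map s, by rwa [hL 0 (by omega)],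
      fun i hi => by rw [hL _ (by omega), hL _ (by omega)]; exact hs i hi, hL n le_rfl⟩
  · rintro ⟨L, h⟩
    exact ⟨fun i => L.getD i 0, h⟩

theorem RecursiveIn.sigmaPred_graph {O : Set ℕ} {f : ℕ →. ℕ} (hf : RecursiveIn O f) {n : ℕ}
    (hO : SigmaPred n fun x => x ∈ O) : SigmaPred (n + 1) fun x : ℕ × ℕ => x.2 ∈ f x.1 := by
  have total : ∀ f : ℕ → ℕ, Primrec f →
      SigmaPred (n + 1) fun x : ℕ × ℕ => x.2 ∈ (f : ℕ →. ℕ) x.1 := fun f hf =>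
    (SigmaPred.eq (f := fun x : ℕ × ℕ => x.2) (g := fun x => f x.1) (by fun_prop)
      (by fun_prop)).of_iff fun x => by simp
  induction hf with
  | zero => exact total (fun _ => 0) (by fun_prop)
  | succ => exact total _ Primrec.succ
  | left => exact total (fun n => n.unpair.1) (by fun_prop)
  | right => exact total (fun n => n.unpair.2) (by fun_prop)
  | oracle =>
    refine (((hO.comp Primrec.fst).succ.and (.eq Primrec.snd (Primrec.const 1))).or
      ((hO.comp Primrec.fst).not.and (.eq Primrec.snd (Primrec.const 0)))).of_iff fun x => ?_
    by_cases h : x.1 ∈ O <;> simp [h, Part.one_def, Part.zero_def]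
  | @pair f g _ _ ihf ihg =>
    refine (SigmaPred.ex (p := fun (x : ℕ × ℕ) (y : ℕ × ℕ) => y.1 ∈ f x.1 ∧ y.2 ∈ g x.1 ∧
      Nat.pair y.1 y.2 = x.2) ((ihf.comp (f := fun x : (ℕ × ℕ) × (ℕ × ℕ) => (x.1.1, x.2.1))
        (by fun_prop)).and ((ihg.comp (f := fun x : (ℕ × ℕ) × (ℕ × ℕ) => (x.1.1, x.2.2))
        (by fun_prop)).and (.eq (by fun_prop) (by fun_prop))))).of_iff fun x => ?_
    simp [Seq.seq, eq_comm]
  | @comp f g _ _ ihf ihg =>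
    refine (SigmaPred.ex (p := fun (x : ℕ × ℕ) (y : ℕ) => y ∈ g x.1 ∧ x.2 ∈ f y)
      ((ihg.comp (f := fun x : (ℕ × ℕ) × ℕ => (x.1.1, x.2)) (by fun_prop)).and
      (ihf.comp (f := fun x : (ℕ × ℕ) × ℕ => (x.2, x.1.2)) (by fun_prop)))).of_iff fun x => ?_
    exact Part.mem_bind_iff
  | @prec f g _ _ ihf ihg =>
    refine (SigmaPred.ex (p := fun (x : ℕ × ℕ) (L : List ℕ) =>
      L.getD 0 0 ∈ f x.1.unpair.1 ∧ (∀ i < x.1.unpair.2, L.getD (i + 1) 0 ∈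
        g (Nat.pair x.1.unpair.1 (Nat.pair i (L.getD i 0)))) ∧ L.getD x.1.unpair.2 0 = x.2)
      ((ihf.comp (f := fun x : (ℕ × ℕ) × List ℕ => (x.1.1.unpair.1, x.2.getD 0 0))
        (by fun_prop)).and ((SigmaPred.forall_lt (by fun_prop) ?_).and
          (.eq (by fun_prop) (by fun_prop))))).of_iff fun x => ?_
    · exact ihg.comp (f := fun x : ((ℕ × ℕ) × List ℕ) × ℕ =>
        (Nat.pair x.1.1.1.unpair.1 (Nat.pair x.2 (x.1.2.getD x.2 0)), x.1.2.getD (x.2 + 1) 0))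
        (by fun_prop)
    · exact mem_natRec_iff _ (fun y i => g (Nat.pair x.1.unpair.1 (Nat.pair y i))) _ _
  | @rfind f _ ihf =>
    refine ((ihf.comp (f := fun x : ℕ × ℕ => (Nat.pair x.1 x.2, 0)) (by fun_prop)).and
      (SigmaPred.forall_lt (f := fun x : ℕ × ℕ => x.2)
        (p := fun x i => ∃ w, w ∈ f (Nat.pair x.1 i) ∧ 0 < w) (by fun_prop)
        (SigmaPred.ex ((ihf.comp (f := fun x : ((ℕ × ℕ) × ℕ) × ℕ =>
          (Nat.pair x.1.1.1 x.1.2, x.2)) (by fun_prop)).and (.lt (by fun_prop)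
            (by fun_prop)))))).of_iff fun x => ?_
    refine Nat.mem_rfind.trans (and_congr ?_ (forall₂_congr fun i _ => ?_))
    · exact (Part.mem_map_iff _).trans (by simp)
    · exact (Part.mem_map_iff _).trans (by simp [Nat.pos_iff_ne_zero])

/-- The relation `R` is defined in `ℕ` by a `Σₙ`-formula. -/
def SigmaDef (n : ℕ) {k : ℕ} (R : (Fin k → ℕ) → Prop) : Prop :=
  ∃ φ : LA.BoundedFormula Empty k, IsSigma n φ ∧ ∀ v, φ.Realize (fun e => Empty.elim e) v ↔ R v

/-- The function `p` is the value of a term in `ℕ`. -/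
def TermDef {k : ℕ} (p : (Fin k → ℕ) → ℕ) : Prop :=
  ∃ t : LA.Term (Empty ⊕ Fin k), ∀ v, t.realize (Sum.elim (fun e => Empty.elim e) v) = p v

namespace TermDef

variable {k : ℕ} {p q : (Fin k → ℕ) → ℕ}

theorem var (i : Fin k) : TermDef fun v => v i := ⟨&i, fun _ => rfl⟩

theorem zero : TermDef fun _ : Fin k → ℕ => 0 := ⟨zeroT, fun _ => rfl⟩

theorem succ (hp : TermDef p) : TermDef fun v => p v + 1 := by
  obtain ⟨t, ht⟩ := hp
  exact ⟨succT t, fun v => congrArg (· + 1) (ht v)⟩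

theorem add (hp : TermDef p) (hq : TermDef q) : TermDef fun v => p v + q v := by
  obtain ⟨t, ht⟩ := hp
  obtain ⟨s, hs⟩ := hq
  exact ⟨addT t s, fun v => congrArg₂ (· + ·) (ht v) (hs v)⟩

theorem mul (hp : TermDef p) (hq : TermDef q) : TermDef fun v => p v * q v := by
  obtain ⟨t, ht⟩ := hp
  obtain ⟨s, hs⟩ := hq
  exact ⟨mulT t s, fun v => congrArg₂ (· * ·) (ht v) (hs v)⟩

theorem lift (hp : TermDef p) : TermDef fun w : Fin (k + 1) → ℕ => p (Fin.init w) := by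
  obtain ⟨t, ht⟩ := hp
  refine ⟨liftT t, fun w => ?_⟩
  change _ = p (Fin.init w)
  rw [← ht, liftT, Term.realize_relabel]
  congr 1
  ext x
  rcases x with x | x
  · exact x.elim
  · rfl

theorem last : TermDef fun w : Fin (k + 1) → ℕ => w (Fin.last k) := var _

end TermDef

theorem Delta0.isSigma_isPi {k : ℕ} {φ : LA.BoundedFormula Empty k} (h : Delta0 φ) (n : ℕ) :
    IsSigma n φ ∧ IsPi n φ := by
  induction n with
  | zero => exact ⟨.ofDelta0 h, .ofDelta0 h⟩
  | succ n ih => exact ⟨.ofPi ih.2, .ofSigma ih.1⟩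

/-- The interpretation of `≤` in a structure. -/
def LeIn {M : Type} [LA.Structure M] (a b : M) : Prop :=
  Structure.RelMap (L := LA) (n := 2) ArithRel.le ![a, b]

theorem leIn_nat {a b : ℕ} : LeIn a b ↔ a ≤ b := Iff.rfl

theorem realize_leF {M : Type} [LA.Structure M] {k : ℕ} (t s : LA.Term (Empty ⊕ Fin k))
    (e : Empty → M) (v : Fin k → M) : (leF t s).Realize e v ↔
      LeIn (t.realize (Sum.elim e v)) (s.realize (Sum.elim e v)) := by
  change Structure.RelMap (L := LA) ArithRel.le
    (fun i => (![t, s] i).realize (Sum.elim e v)) ↔ _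
  rw [show (fun i => (![t, s] i).realize (Sum.elim e v)) =
    ![t.realize (Sum.elim e v), s.realize (Sum.elim e v)] from
      funext fun i => by fin_cases i <;> rfl]
  rfl

theorem realize_liftT {M : Type} [LA.Structure M] {k : ℕ} (t : LA.Term (Empty ⊕ Fin k))
    (e : Empty → M) (v : Fin k → M) (a : M) :
    (liftT t).realize (Sum.elim e (Fin.snoc v a : Fin (k + 1) → M)) =
      t.realize (Sum.elim e v) := by
  rw [liftT, Term.realize_relabel]
  congr 1
  ext x
  rcases x with x | x
  · rfl
  · simp

theorem realize_bdall {M : Type} [LA.Structure M] {k : ℕ} (t : LA.Term (Empty ⊕ Fin k))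
    (φ : LA.BoundedFormula Empty (k + 1)) (e : Empty → M) (v : Fin k → M) :
    ((leF (&(Fin.last k)) (liftT t) ⟹ φ).all).Realize e v ↔
      ∀ a, LeIn a (t.realize (Sum.elim e v)) → φ.Realize e (Fin.snoc v a) := by
  simp [realize_leF, realize_liftT]

theorem realize_bdex {M : Type} [LA.Structure M] {k : ℕ} (t : LA.Term (Empty ⊕ Fin k))
    (φ : LA.BoundedFormula Empty (k + 1)) (e : Empty → M) (v : Fin k → M) :
    ((leF (&(Fin.last k)) (liftT t) ⊓ φ).ex).Realize e v ↔
      ∃ a, LeIn a (t.realize (Sum.elim e v)) ∧ φ.Realize e (Fin.snoc v a) := by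
  simp [realize_leF, realize_liftT]

theorem isSigma_not {n k : ℕ} {φ : LA.BoundedFormula Empty k} (h : IsSigma n φ) :
    ∃ ψ : LA.BoundedFormula Empty k, IsPi n ψ ∧
      ∀ v : Fin k → ℕ, ψ.Realize (fun e => Empty.elim e) v ↔
        ¬ φ.Realize (fun e => Empty.elim e) v := by
  refine IsSigma.rec
    (motive_1 := fun n k φ _ => ∃ ψ : LA.BoundedFormula Empty k, IsPi n ψ ∧
      ∀ v : Fin k → ℕ, ψ.Realize (fun e => Empty.elim e) v ↔
        ¬ φ.Realize (fun e => Empty.elim e) v)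
    (motive_2 := fun n k φ _ => ∃ ψ : LA.BoundedFormula Empty k, IsSigma n ψ ∧
      ∀ v : Fin k → ℕ, ψ.Realize (fun e => Empty.elim e) v ↔
        ¬ φ.Realize (fun e => Empty.elim e) v)
    ?_ ?_ ?_ ?_ ?_ ?_ ?_ ?_ ?_ ?_ ?_ ?_ h
  · exact fun {k φ} h => ⟨∼φ, .ofDelta0 (.imp h .falsum), fun v => by simp⟩
  · rintro n k φ - ⟨ψ, h, h'⟩
    exact ⟨ψ, .ofSigma h, h'⟩
  · rintro n k φ - ⟨ψ, h, h'⟩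
    exact ⟨ψ.all, .all h, fun v => by simp [h']⟩
  · rintro n k φ₁ φ₂ - - ⟨ψ₁, h₁, h₁'⟩ ⟨ψ₂, h₂, h₂'⟩
    exact ⟨ψ₁ ⊔ ψ₂, .sup h₁ h₂, fun v => by simp [h₁', h₂', -not_and, not_and_or]⟩
  · rintro n k φ₁ φ₂ - - ⟨ψ₁, h₁, h₁'⟩ ⟨ψ₂, h₂, h₂'⟩
    exact ⟨ψ₁ ⊓ ψ₂, .inf h₁ h₂, fun v => by simp [h₁', h₂']⟩
  · rintro n k t φ - ⟨ψ, h, h'⟩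
    exact ⟨_, .bdex t h, fun v => by simp only [realize_bdex, realize_bdall, h']; simp⟩
  · exact fun {k φ} h => ⟨∼φ, .ofDelta0 (.imp h .falsum), fun v => by simp⟩
  · rintro n k φ - ⟨ψ, h, h'⟩
    exact ⟨ψ, .ofPi h, h'⟩
  · rintro n k φ - ⟨ψ, h, h'⟩
    exact ⟨ψ.ex, .ex h, fun v => by simp [h']⟩
  · rintro n k φ₁ φ₂ - - ⟨ψ₁, h₁, h₁'⟩ ⟨ψ₂, h₂, h₂'⟩
    exact ⟨ψ₁ ⊔ ψ₂, .sup h₁ h₂, fun v => by simp [h₁', h₂', -not_and, not_and_or]⟩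
  · rintro n k φ₁ φ₂ - - ⟨ψ₁, h₁, h₁'⟩ ⟨ψ₂, h₂, h₂'⟩
    exact ⟨ψ₁ ⊓ ψ₂, .inf h₁ h₂, fun v => by simp [h₁', h₂']⟩
  · rintro n k t φ - ⟨ψ, h, h'⟩
    exact ⟨_, .bdall t h, fun v => by simp only [realize_bdex, realize_bdall, h']; simp⟩

namespace SigmaDef

variable {n k : ℕ} {p q : (Fin k → ℕ) → ℕ}

theorem of_iff {R S : (Fin k → ℕ) → Prop} (hR : SigmaDef n R) (h : ∀ v, S v ↔ R v) :
    SigmaDef n S :=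
  (funext fun a => propext (h a) : S = R) ▸ hR

theorem not {R : (Fin k → ℕ) → Prop} (hR : SigmaDef n R) : SigmaDef (n + 1) fun v => ¬ R v := by
  obtain ⟨φ, hφ, h⟩ := hR
  obtain ⟨ψ, hψ, h'⟩ := isSigma_not hφ
  exact ⟨ψ, .ofPi hψ, fun v => by rw [h', h]⟩

theorem and {R S : (Fin k → ℕ) → Prop} (hR : SigmaDef (n + 1) R) (hS : SigmaDef (n + 1) S) :
    SigmaDef (n + 1) fun v => R v ∧ S v := by
  obtain ⟨φ, hφ, h⟩ := hR
  obtain ⟨ψ, hψ, h'⟩ := hS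
  exact ⟨φ ⊓ ψ, .inf hφ hψ, fun v => by rw [realize_inf, h, h']⟩

theorem or {R S : (Fin k → ℕ) → Prop} (hR : SigmaDef (n + 1) R) (hS : SigmaDef (n + 1) S) :
    SigmaDef (n + 1) fun v => R v ∨ S v := by
  obtain ⟨φ, hφ, h⟩ := hR
  obtain ⟨ψ, hψ, h'⟩ := hS
  exact ⟨φ ⊔ ψ, .sup hφ hψ, fun v => by rw [realize_sup, h, h']⟩

theorem ex {R : (Fin k → ℕ) → ℕ → Prop}
    (hR : SigmaDef (n + 1) fun w : Fin (k + 1) → ℕ => R (Fin.init w) (w (Fin.last k))) :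
    SigmaDef (n + 1) fun v => ∃ a, R v a := by
  obtain ⟨φ, hφ, h⟩ := hR
  exact ⟨φ.ex, .ex hφ, fun v => by simp [realize_ex, h]⟩

theorem forall_le (hp : TermDef p) {R : (Fin k → ℕ) → ℕ → Prop}
    (hR : SigmaDef (n + 1) fun w : Fin (k + 1) → ℕ => R (Fin.init w) (w (Fin.last k))) :
    SigmaDef (n + 1) fun v => ∀ a ≤ p v, R v a := by
  obtain ⟨φ, hφ, h⟩ := hR
  obtain ⟨t, ht⟩ := hp
  refine ⟨_, .bdall t hφ, fun v => ?_⟩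
  rw [realize_bdall]
  refine forall_congr' fun a => imp_congr ?_ (by simp [h])
  rw [ht, leIn_nat]

theorem eq (hp : TermDef p) (hq : TermDef q) : SigmaDef n fun v => p v = q v := by
  obtain ⟨t, ht⟩ := hp
  obtain ⟨s, hs⟩ := hq
  exact ⟨t =' s, ((Delta0.equal t s).isSigma_isPi n).1, fun v => by
    rw [realize_bdEqual, ht, hs]⟩

theorem le (hp : TermDef p) (hq : TermDef q) : SigmaDef n fun v => p v ≤ q v := by
  obtain ⟨t, ht⟩ := hp
  obtain ⟨s, hs⟩ := hq
  exact ⟨leF t s, ((Delta0.le t s).isSigma_isPi n).1, fun v => by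
    rw [realize_leF, ht, hs, leIn_nat]⟩

theorem natPair {r : (Fin k → ℕ) → ℕ} (hp : TermDef p) (hq : TermDef q) (hr : TermDef r) :
    SigmaDef (n + 1) fun v => Nat.pair (p v) (q v) = r v := by
  refine (((le hp.succ hq).and (eq ((hq.mul hq).add hp) hr)).or
    ((le hq hp).and (eq (((hp.mul hp).add hp).add hq) hr))).of_iff fun v => ?_
  rcases lt_or_ge (p v) (q v) with h | h
  · simp [Nat.pair, h, Nat.not_le.2 h]
  · simp [Nat.pair, h, Nat.not_lt.2 h]

/-- The graph of the function `(c, d, i) ↦ c % ((i + 1) * d + 1)` underlying `Nat.beta`. -/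
theorem mod_beta {c d i y : (Fin k → ℕ) → ℕ} (hc : TermDef c) (hd : TermDef d) (hi : TermDef i)
    (hy : TermDef y) : SigmaDef (n + 1) fun v => c v % ((i v + 1) * d v + 1) = y v := by
  refine ((le hy (hi.succ.mul hd)).and (ex (R := fun v u => u * ((i v + 1) * d v + 1) + y v = c v)
    (eq ((TermDef.last.mul (hi.succ.mul hd).succ.lift).add hy.lift) hc.lift))).of_iff fun v => ?_
  constructor
  · intro h
    rw [← h]
    exact ⟨Nat.lt_succ_iff.1 (Nat.mod_lt _ (Nat.succ_pos _)), _, Nat.div_add_mod' _ _⟩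
  · rintro ⟨h, u, hu⟩
    rw [← hu, Nat.mul_add_mod', Nat.mod_eq_of_lt (Nat.lt_succ_iff.2 h)]

theorem of_natPrimrec {f : ℕ → ℕ} (hf : Nat.Primrec f) : ∀ {k : ℕ} {p q : (Fin k → ℕ) → ℕ},
    TermDef p → TermDef q → SigmaDef (n + 1) fun v => f (p v) = q v := by
  induction hf with
  | zero => exact fun hp hq => eq .zero hq
  | succ => exact fun hp hq => eq hp.succ hq
  | left =>
    intro k p q hp hq
    refine (ex (R := fun v b => Nat.pair (q v) b = p v)
      (natPair hq.lift .last hp.lift)).of_iff fun v => ⟨fun h => ⟨(p v).unpair.2, ?_⟩, ?_⟩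
    · rw [← h, Nat.pair_unpair]
    · rintro ⟨b, hb⟩
      simp [← hb]
  | right =>
    intro k p q hp hq
    refine (ex (R := fun v b => Nat.pair b (q v) = p v)
      (natPair .last hq.lift hp.lift)).of_iff fun v => ⟨fun h => ⟨(p v).unpair.1, ?_⟩, ?_⟩
    · rw [← h, Nat.pair_unpair]
    · rintro ⟨b, hb⟩
      simp [← hb]
  | @pair f g _ _ ihf ihg =>
    intro k p q hp hq
    exact (ex (R := fun v a => ∃ b, f (p v) = a ∧ g (p v) = b ∧ Nat.pair a b = q v)
      (ex (R := fun v b => f (p (Fin.init v)) = v (Fin.last k) ∧ g (p (Fin.init v)) = b ∧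
        Nat.pair (v (Fin.last k)) b = q (Fin.init v)) ((ihf hp.lift.lift TermDef.last.lift).and
          ((ihg hp.lift.lift .last).and
            (natPair TermDef.last.lift .last hq.lift.lift))))).of_iff fun v => by simp
  | @comp f g _ _ ihf ihg =>
    intro k p q hp hq
    exact (ex (R := fun v a => g (p v) = a ∧ f a = q v)
      ((ihg hp.lift .last).and (ihf .last hq.lift))).of_iff fun v => by simp
  | @prec f g _ _ ihf ihg =>
    intro k p q hp hq
    have hstep : ∀ {k : ℕ} {a i y z : (Fin k → ℕ) → ℕ}, TermDef a → TermDef i → TermDef y →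
        TermDef z → SigmaDef (n + 1) fun v => g (Nat.pair (a v) (Nat.pair (i v) (y v))) = z v :=
      fun {k a i y z} ha hi hy hz => (ex (R := fun v u => Nat.pair (i v) (y v) = u ∧
        ∃ w, Nat.pair (a v) u = w ∧ g w = z v) ((natPair hi.lift hy.lift .last).and
          (ex (R := fun v w => Nat.pair (a (Fin.init v)) (v (Fin.last k)) = w ∧
            g w = z (Fin.init v)) ((natPair ha.lift.lift TermDef.last.lift .last).and
              (ihg .last hz.lift.lift))))).of_iff fun v => by simp
    have hbody : ∀ {k : ℕ} {a m c d z : (Fin k → ℕ) → ℕ}, TermDef a → TermDef m → TermDef c →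
        TermDef d → TermDef z → SigmaDef (n + 1) fun v =>
          f (a v) = c v % ((0 + 1) * d v + 1) ∧ c v % ((m v + 1) * d v + 1) = z v ∧
          ∀ i ≤ m v, i = m v ∨ g (Nat.pair (a v) (Nat.pair i (c v % ((i + 1) * d v + 1)))) =
            c v % ((i + 1 + 1) * d v + 1) := by
      intro k a m c d z ha hm hc hd hz
      refine SigmaDef.and ?_ ((mod_beta hc hd hm hz).and (forall_le hm
        (.or (.eq .last hm.lift) ?_)))
      · exact (ex (R := fun v y => c v % ((0 + 1) * d v + 1) = y ∧ f (a v) = y)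
          ((mod_beta hc.lift hd.lift .zero .last).and (ihf ha.lift .last))).of_iff fun v => by simp
      · exact (ex (R := fun v y => c (Fin.init v) % ((v (Fin.last k) + 1) * d (Fin.init v) + 1) = y
            ∧ ∃ y', c (Fin.init v) % ((v (Fin.last k) + 1 + 1) * d (Fin.init v) + 1) = y' ∧
              g (Nat.pair (a (Fin.init v)) (Nat.pair (v (Fin.last k)) y)) = y')
          ((mod_beta hc.lift.lift hd.lift.lift TermDef.last.lift .last).and
            (ex (R := fun v y' => c (Fin.init (Fin.init v)) %
                ((Fin.init v (Fin.last k) + 1 + 1) * d (Fin.init (Fin.init v)) + 1) = y' ∧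
              g (Nat.pair (a (Fin.init (Fin.init v)))
                (Nat.pair (Fin.init v (Fin.last k)) (v (Fin.last (k + 1))))) = y')
              ((mod_beta hc.lift.lift.lift hd.lift.lift.lift TermDef.last.lift.lift.succ .last).and
                (hstep ha.lift.lift.lift TermDef.last.lift.lift TermDef.last.lift
                  .last))))).of_iff fun v => by simp
    refine (ex (R := fun v a => ∃ m c d, Nat.pair a m = p v ∧
      f a = c % ((0 + 1) * d + 1) ∧ c % ((m + 1) * d + 1) = q v ∧
          ∀ i ≤ m, i = m ∨ g (Nat.pair a (Nat.pair i (c % ((i + 1) * d + 1)))) =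
            c % ((i + 1 + 1) * d + 1)) (ex (ex (ex (SigmaDef.and
              (natPair TermDef.last.lift.lift.lift TermDef.last.lift.lift hp.lift.lift.lift.lift)
              (hbody TermDef.last.lift.lift.lift TermDef.last.lift.lift TermDef.last.lift
                TermDef.last hq.lift.lift.lift.lift)))))).of_iff fun v => ?_
    simp only [Nat.unpaired]
    constructor
    · intro h
      let F : ℕ → ℕ := fun m => Nat.rec (f (p v).unpair.1)
        (fun y IH => g (Nat.pair (p v).unpair.1 (Nat.pair y IH))) m
      let l := (List.range ((p v).unpair.2 + 2)).map F
      have hl : ∀ i < (p v).unpair.2 + 2, (Nat.unbeta l).unpair.1 %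
          ((i + 1) * (Nat.unbeta l).unpair.2 + 1) = F i := fun i hi => by
        have := Nat.beta_unbeta_coe l ⟨i, by simpa [l] using hi⟩
        simpa [Nat.beta, l] using this
      refine ⟨(p v).unpair.1, (p v).unpair.2, (Nat.unbeta l).unpair.1, (Nat.unbeta l).unpair.2,
        Nat.pair_unpair _, (hl 0 (by omega)).symm, ?_, fun i hi => Or.inr ?_⟩
      · rw [hl _ (by omega)]
        exact h
      · rw [hl i (by omega), hl (i + 1) (by omega)]
    · rintro ⟨a, m, c, d, hp, h0, hm, hs⟩
      rw [← hp, Nat.unpair_pair, ← hm]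
      have : ∀ j ≤ m, (Nat.rec (f a) (fun y IH => g (Nat.pair a (Nat.pair y IH))) j : ℕ) =
          c % ((j + 1) * d + 1) := by
        intro j
        induction j with
        | zero => exact fun _ => h0
        | succ j ih =>
          intro hj
          rcases hs j (by omega) with h | h
          · omega
          · rw [← h, ← ih (by omega)]
      exact this m le_rfl

end SigmaDef

theorem SigmaPred.sigmaDef {n : ℕ} : ∀ {p : ℕ → Prop}, SigmaPred (n + 1) p → ∀ {k : ℕ}
    {t : (Fin k → ℕ) → ℕ}, TermDef t → SigmaDef (n + 1) fun v => p (t v) := by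
  have reduce : ∀ {m : ℕ} {p : ℕ → Prop}, SigmaPred (m + 1) p →
      ∃ q : ℕ → Prop, SigmaPred m q ∧ ∀ a, p a ↔ ∃ y, ¬ q (Nat.pair a y) := by
    rintro m p ⟨q, hq, h⟩
    exact ⟨fun m => q m.unpair, hq.comp (by fun_prop), by simpa using h⟩
  induction n with
  | zero =>
    intro p hp k t ht
    obtain ⟨q, hq, h⟩ := reduce hp
    classical
    have hf : Nat.Primrec fun m => (decide (q m)).toNat :=
      Primrec.nat_iff.1 ((Primrec.dom_finite Bool.toNat).comp (PrimrecPred.decide hq))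
    refine (SigmaDef.ex (R := fun v y => ∃ z, Nat.pair (t v) y = z ∧
      (decide (q z)).toNat = 0) (SigmaDef.ex (SigmaDef.and
        (SigmaDef.natPair ht.lift.lift TermDef.last.lift .last)
        (SigmaDef.of_natPrimrec hf .last .zero)))).of_iff fun v => ?_
    simp [h]
  | succ n ih =>
    intro p hp k t ht
    obtain ⟨q, hq, h⟩ := reduce hp
    refine (SigmaDef.ex (R := fun v y => ∃ z, Nat.pair (t v) y = z ∧ ¬ q z)
      (SigmaDef.ex (SigmaDef.and (SigmaDef.natPair ht.lift.lift TermDef.last.lift .last)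
        (ih hq .last).not))).of_iff fun v => ?_
    simp [h]

section Coding

/-- The list of numbers coding the list of symbols of a term. -/
def termCode {k : ℕ} (t : LA.Term (Empty ⊕ Fin k)) : List ℕ := t.listEncode.map Encodable.encode

/-- The list of numbers coding the list of symbols of a formula. -/
def formCode {k : ℕ} (φ : LA.BoundedFormula Empty k) : List ℕ := φ.listEncode.map Encodable.encode

theorem encode_map_encode {α : Type} [Encodable α] (l : List α) :
    Encodable.encode (l.map Encodable.encode) = Encodable.encode l := by
  induction l with
  | nil => rfl
  | cons a l ih => simp [ih]

theorem godel_eq {k : ℕ} (φ : LA.BoundedFormula Empty k) :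
    godel φ = Encodable.encode (formCode φ) := (encode_map_encode _).symm

theorem formCode_injective {k k' : ℕ} {φ : LA.BoundedFormula Empty k}
    {ψ : LA.BoundedFormula Empty k'} (h : formCode φ = formCode ψ) :
    (⟨k, φ⟩ : Σ k, LA.BoundedFormula Empty k) = ⟨k', ψ⟩ :=
  listEncode_sigma_injective (List.map_injective_iff.2 Encodable.encode_injective h)

theorem godel_injective {k : ℕ} : Function.Injective (godel (k := k)) := fun φ ψ h => by
  rw [godel_eq, godel_eq] at h
  exact eq_of_heq (Sigma.mk.inj_iff.1 (formCode_injective (Encodable.encode_injective h))).2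

def varC (i : ℕ) : List ℕ := [2 * (2 * i + 1)]
def zeroC : List ℕ := [1]
def succC (t : List ℕ) : List ℕ := 3 :: t
def addC (t s : List ℕ) : List ℕ := 5 :: (t ++ s)
def mulC (t s : List ℕ) : List ℕ := 7 :: (t ++ s)
def atomC (k : ℕ) (t : List ℕ) : ℕ := 2 * Nat.pair k (Encodable.encode t)
def eqC (k : ℕ) (t s : List ℕ) : List ℕ := [atomC k t, atomC k s]
def leC (k : ℕ) (t s : List ℕ) : List ℕ := [1, 4 * k + 3, atomC k t, atomC k s]
def botC (k : ℕ) : List ℕ := [4 * (k + 2) + 3]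
def impC (c d : List ℕ) : List ℕ := 3 :: (c ++ d)
def allC (c : List ℕ) : List ℕ := 7 :: c
def notC (k : ℕ) (c : List ℕ) : List ℕ := impC c (botC k)
def exC (k : ℕ) (c : List ℕ) : List ℕ := notC k (allC (notC (k + 1) c))
def infC (k : ℕ) (c d : List ℕ) : List ℕ := notC k (impC c (notC k d))
def supC (k : ℕ) (c d : List ℕ) : List ℕ := impC (notC k c) d
def bdallC (k : ℕ) (t c : List ℕ) : List ℕ := allC (impC (leC (k + 1) (varC k) t) c)
def bdexC (k : ℕ) (t c : List ℕ) : List ℕ := exC k (infC (k + 1) (leC (k + 1) (varC k) t) c)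

section Primrec

variable {α : Type} [Primcodable α] {f : α → ℕ} {g h : α → List ℕ}

@[fun_prop] theorem primrec_varC (hf : Primrec f) : Primrec fun a => varC (f a) := by
  unfold varC; fun_prop
@[fun_prop] theorem primrec_succC (hg : Primrec g) : Primrec fun a => succC (g a) := by
  unfold succC; fun_prop
@[fun_prop] theorem primrec_addC (hg : Primrec g) (hh : Primrec h) :
    Primrec fun a => addC (g a) (h a) := by unfold addC; fun_prop
@[fun_prop] theorem primrec_mulC (hg : Primrec g) (hh : Primrec h) :
    Primrec fun a => mulC (g a) (h a) := by unfold mulC; fun_prop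
@[fun_prop] theorem primrec_atomC (hf : Primrec f) (hg : Primrec g) :
    Primrec fun a => atomC (f a) (g a) := by unfold atomC; fun_prop
@[fun_prop] theorem primrec_eqC (hf : Primrec f) (hg : Primrec g) (hh : Primrec h) :
    Primrec fun a => eqC (f a) (g a) (h a) := by unfold eqC; fun_prop
@[fun_prop] theorem primrec_leC (hf : Primrec f) (hg : Primrec g) (hh : Primrec h) :
    Primrec fun a => leC (f a) (g a) (h a) := by unfold leC; fun_prop
@[fun_prop] theorem primrec_botC (hf : Primrec f) : Primrec fun a => botC (f a) := by
  unfold botC; fun_prop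
@[fun_prop] theorem primrec_impC (hg : Primrec g) (hh : Primrec h) :
    Primrec fun a => impC (g a) (h a) := by unfold impC; fun_prop
@[fun_prop] theorem primrec_allC (hg : Primrec g) : Primrec fun a => allC (g a) := by
  unfold allC; fun_prop
@[fun_prop] theorem primrec_notC (hf : Primrec f) (hg : Primrec g) :
    Primrec fun a => notC (f a) (g a) := by unfold notC; fun_prop
@[fun_prop] theorem primrec_exC (hf : Primrec f) (hg : Primrec g) :
    Primrec fun a => exC (f a) (g a) := by unfold exC; fun_prop
@[fun_prop] theorem primrec_infC (hf : Primrec f) (hg : Primrec g) (hh : Primrec h) :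
    Primrec fun a => infC (f a) (g a) (h a) := by unfold infC; fun_prop
@[fun_prop] theorem primrec_supC (hf : Primrec f) (hg : Primrec g) (hh : Primrec h) :
    Primrec fun a => supC (f a) (g a) (h a) := by unfold supC; fun_prop
@[fun_prop] theorem primrec_bdallC (hf : Primrec f) (hg : Primrec g) (hh : Primrec h) :
    Primrec fun a => bdallC (f a) (g a) (h a) := by unfold bdallC; fun_prop
@[fun_prop] theorem primrec_bdexC (hf : Primrec f) (hg : Primrec g) (hh : Primrec h) :
    Primrec fun a => bdexC (f a) (g a) (h a) := by unfold bdexC; fun_prop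

end Primrec

section Codes

variable {k : ℕ} (t s : LA.Term (Empty ⊕ Fin k)) (φ ψ : LA.BoundedFormula Empty k)
  (χ : LA.BoundedFormula Empty (k + 1))

theorem termCode_var (i : Fin k) :
    termCode (Term.var (Sum.inr i) : LA.Term (Empty ⊕ Fin k)) = varC i := rfl

theorem termCode_zeroT : termCode (zeroT : LA.Term (Empty ⊕ Fin k)) = zeroC := rfl

theorem termCode_succT : termCode (succT t) = succC (termCode t) := by
  change Encodable.encode _ :: List.map _ (t.listEncode ++ []) = _
  rw [List.append_nil]
  rfl

theorem termCode_addT : termCode (addT t s) = addC (termCode t) (termCode s) := by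
  change Encodable.encode _ :: List.map _ (t.listEncode ++ (s.listEncode ++ [])) = _
  rw [List.append_nil, List.map_append]
  rfl

theorem termCode_mulT : termCode (mulT t s) = mulC (termCode t) (termCode s) := by
  change Encodable.encode _ :: List.map _ (t.listEncode ++ (s.listEncode ++ [])) = _
  rw [List.append_nil, List.map_append]
  rfl

theorem encode_term : Encodable.encode t = Encodable.encode (termCode t) :=
  (encode_map_encode _).symm

theorem encode_atom : Encodable.encode (Sum.inl ⟨k, t⟩ :
    (Σ k, LA.Term (Empty ⊕ Fin k)) ⊕ ((Σ n, LA.Relations n) ⊕ ℕ)) = atomC k (termCode t) := by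
  change 2 * Nat.pair k (Encodable.encode t) = _
  rw [encode_term]
  rfl

theorem formCode_bot : formCode (⊥ : LA.BoundedFormula Empty k) = botC k := by
  change [2 * (2 * (k + 2) + 1) + 1] = [4 * (k + 2) + 3]
  congr 1
  ring

theorem formCode_equal : formCode (t =' s) = eqC k (termCode t) (termCode s) := by
  change [Encodable.encode (Sum.inl _), Encodable.encode (Sum.inl _)] = _
  rw [encode_atom, encode_atom]
  rfl

theorem formCode_leF : formCode (leF t s) = leC k (termCode t) (termCode s) := by
  change [1, 2 * (2 * k + 1) + 1, Encodable.encode (Sum.inl _), Encodable.encode (Sum.inl _)] = _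
  rw [encode_atom, encode_atom, leC, show 2 * (2 * k + 1) + 1 = 4 * k + 3 by ring]
  rfl

theorem formCode_imp : formCode (φ ⟹ ψ) = impC (formCode φ) (formCode ψ) :=
  List.map_append (l₁ := Sum.inr (Sum.inr 0) :: φ.listEncode)

theorem formCode_all : formCode χ.all = allC (formCode χ) := rfl

theorem formCode_not : formCode (∼φ) = notC k (formCode φ) := by
  rw [notC, ← formCode_bot, ← formCode_imp]
  rfl

theorem formCode_ex : formCode χ.ex = exC k (formCode χ) := by
  rw [exC, ← formCode_not, ← formCode_all, ← formCode_not]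
  rfl

theorem formCode_inf : formCode (φ ⊓ ψ) = infC k (formCode φ) (formCode ψ) := by
  rw [infC, ← formCode_not, ← formCode_imp, ← formCode_not]
  rfl

theorem formCode_sup : formCode (φ ⊔ ψ) = supC k (formCode φ) (formCode ψ) := by
  rw [supC, ← formCode_not, ← formCode_imp]
  rfl

end Codes

@[elab_as_elim]
theorem term_induction {α : Type} {motive : LA.Term α → Prop} (var : ∀ x, motive (.var x))
    (zero : motive zeroT) (succ : ∀ t, motive t → motive (succT t))
    (add : ∀ t s, motive t → motive s → motive (addT t s))
    (mul : ∀ t s, motive t → motive s → motive (mulT t s)) (t : LA.Term α) : motive t := by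
  induction t with
  | var x => exact var x
  | @func n f ts ih =>
    have h1 : ∀ us : Fin 1 → LA.Term α, us = ![us 0] := fun us => by
      ext i; fin_cases i; rfl
    have h2 : ∀ us : Fin 2 → LA.Term α, us = ![us 0, us 1] := fun us => by
      ext i; fin_cases i <;> rfl
    match n, f, ts, ih with
    | _, ArithFunc.zero, ts, _ => exact (Subsingleton.elim ts ![]) ▸ zero
    | _, ArithFunc.succ, ts, ih => exact (h1 ts) ▸ succ _ (ih 0)
    | _, ArithFunc.add, ts, ih => exact (h2 ts) ▸ add _ _ (ih 0) (ih 1)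
    | _, ArithFunc.mul, ts, ih => exact (h2 ts) ▸ mul _ _ (ih 0) (ih 1)

@[elab_as_elim]
theorem form_induction {motive : ∀ k, LA.BoundedFormula Empty k → Prop}
    (falsum : ∀ k, motive k ⊥) (equal : ∀ k t s, motive k (t =' s))
    (le : ∀ k t s, motive k (leF t s))
    (imp : ∀ k φ ψ, motive k φ → motive k ψ → motive k (φ ⟹ ψ))
    (all : ∀ k φ, motive (k + 1) φ → motive k φ.all) {k : ℕ} (φ : LA.BoundedFormula Empty k) :
    motive k φ := by
  induction φ with
  | falsum => exact falsum _
  | equal t s => exact equal _ t s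
  | @rel k l R ts =>
    match l, R, ts with
    | _, ArithRel.le, ts =>
      have h : ts = ![ts 0, ts 1] := by ext i; fin_cases i <;> rfl
      rw [h]
      exact le _ _ _
  | imp φ ψ h h' => exact imp _ _ _ h h'
  | all φ h => exact all _ _ h

theorem termCode_liftT {k : ℕ} (t : LA.Term (Empty ⊕ Fin k)) : termCode (liftT t) = termCode t := by
  induction t using term_induction with
  | var x =>
    rcases x with x | x
    · exact x.elim
    · rfl
  | zero => rfl
  | succ t h =>
    rw [termCode_succT, ← h, ← termCode_succT]
    exact congrArg termCode (congrArg (Term.func _) (funext fun i => by fin_cases i; rfl))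
  | add t s h h' =>
    rw [termCode_addT, ← h, ← h', ← termCode_addT]
    exact congrArg termCode (congrArg (Term.func _) (funext fun i => by fin_cases i <;> rfl))
  | mul t s h h' =>
    rw [termCode_mulT, ← h, ← h', ← termCode_mulT]
    exact congrArg termCode (congrArg (Term.func _) (funext fun i => by fin_cases i <;> rfl))

theorem formCode_bdall {k : ℕ} (t : LA.Term (Empty ⊕ Fin k)) (φ : LA.BoundedFormula Empty (k + 1)) :
    formCode (leF (&(Fin.last k)) (liftT t) ⟹ φ).all = bdallC k (termCode t) (formCode φ) := by
  rw [formCode_all, formCode_imp, formCode_leF, termCode_liftT]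
  rfl

theorem formCode_bdex {k : ℕ} (t : LA.Term (Empty ⊕ Fin k)) (φ : LA.BoundedFormula Empty (k + 1)) :
    formCode (leF (&(Fin.last k)) (liftT t) ⊓ φ).ex = bdexC k (termCode t) (formCode φ) := by
  rw [formCode_ex, formCode_inf, formCode_leF, termCode_liftT]
  rfl

end Coding

section Truth

/-- `x = (t, l, m)` where `t` codes a term with value `m` under the assignment `l`. -/
def TermVal [LA.Structure ℕ] (x : List ℕ × List ℕ × ℕ) : Prop :=
  ∃ (k : ℕ) (t : LA.Term (Empty ⊕ Fin k)) (v : Fin k → ℕ),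
    x = (termCode t, List.ofFn v, t.realize (Sum.elim (fun e => Empty.elim e) v))

theorem sigmaPred_termVal_of_primrec [LA.Structure ℕ] {z : ℕ} {f : ℕ → ℕ} {g h : ℕ × ℕ → ℕ}
    (hf : Primrec f) (hg : Primrec g) (hh : Primrec h)
    (fun_zero : ∀ v, Structure.funMap (L := LA) ArithFunc.zero v = z)
    (fun_succ : ∀ v, Structure.funMap (L := LA) ArithFunc.succ v = f (v 0))
    (fun_add : ∀ v, Structure.funMap (L := LA) ArithFunc.add v = g (v 0, v 1))
    (fun_mul : ∀ v, Structure.funMap (L := LA) ArithFunc.mul v = h (v 0, v 1)) :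
    SigmaPred 1 TermVal := by
  have realize_zero (k : ℕ) (w : Empty ⊕ Fin k → ℕ) : zeroT.realize w = z := fun_zero _
  have realize_succ (k : ℕ) (w : Empty ⊕ Fin k → ℕ) t : (succT t).realize w = f (t.realize w) :=
    fun_succ _
  have realize_add (k : ℕ) (w : Empty ⊕ Fin k → ℕ) t s :
      (addT t s).realize w = g (t.realize w, s.realize w) := fun_add _
  have realize_mul (k : ℕ) (w : Empty ⊕ Fin k → ℕ) t s :
      (mulT t s).realize w = h (t.realize w, s.realize w) := fun_mul _
  refine SigmaPred.of_generated (n := 0) (step := fun p =>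
    (∃ i < p.2.2.1.length, p.2.1 = varC i ∧ p.2.2.2 = p.2.2.1.getD i 0) ∨
    (p.2.1 = zeroC ∧ p.2.2.2 = z) ∨
    (∃ y ∈ p.1, p.2 = (succC y.1, y.2.1, f y.2.2)) ∨
    (∃ y ∈ p.1, ∃ z ∈ p.1, y.2.1 = z.2.1 ∧ p.2 = (addC y.1 z.1, z.2.1, g (y.2.2, z.2.2))) ∨
    (∃ y ∈ p.1, ∃ z ∈ p.1, y.2.1 = z.2.1 ∧ p.2 = (mulC y.1 z.1, z.2.1, h (y.2.2, z.2.2))))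
    (by fun_prop) ?_ ?_ ?_
  · intro D D' a h
    grind
  · rintro D ⟨t, l, m⟩ hD (⟨i, hi, ht, hm⟩ | ⟨ht, hm⟩ | ⟨y, hy, h⟩ | ⟨y, hy, z, hz, hyz, h⟩ |
      ⟨y, hy, z, hz, hyz, h⟩)
    · dsimp only at hi ht hm
      subst ht hm
      refine ⟨l.length, Term.var (Sum.inr ⟨i, hi⟩), l.get, ?_⟩
      rw [List.ofFn_get, termCode_var, List.getD_eq_getElem _ _ hi]
      rfl
    · dsimp only at ht hm
      subst ht hm
      exact ⟨l.length, zeroT, l.get, by rw [List.ofFn_get, realize_zero, termCode_zeroT]⟩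
    · obtain ⟨k, t, v, rfl⟩ := hD _ hy
      exact ⟨k, succT t, v, by rw [termCode_succT, realize_succ]; exact h⟩
    · obtain ⟨k, t, v, rfl⟩ := hD _ hy
      obtain ⟨k', s, v', rfl⟩ := hD _ hz
      cases List.ofFn_inj'.1 hyz
      exact ⟨k, addT t s, v, by rw [termCode_addT, realize_add]; exact h⟩
    · obtain ⟨k, t, v, rfl⟩ := hD _ hy
      obtain ⟨k', s, v', rfl⟩ := hD _ hz
      cases List.ofFn_inj'.1 hyz
      exact ⟨k, mulT t s, v, by rw [termCode_mulT, realize_mul]; exact h⟩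
  · rintro _ ⟨k, t, v, rfl⟩
    induction t using term_induction with
    | var x =>
      rcases x with x | i
      · exact x.elim
      · refine .intro [] _ (by simp) (Or.inl ⟨i, by simp, rfl, ?_⟩)
        simp
    | zero =>
      exact .intro [] _ (by simp) (Or.inr (Or.inl ⟨termCode_zeroT, realize_zero k _⟩))
    | succ t h =>
      refine .intro [_] _ (List.forall_mem_singleton.2 h)
        (Or.inr (Or.inr (Or.inl ⟨_, List.mem_singleton_self _, ?_⟩)))
      rw [termCode_succT, realize_succ]
    | add t s h h' =>
      refine .intro [_, _] _ (List.forall_mem_cons.2 ⟨h, List.forall_mem_singleton.2 h'⟩)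
        (Or.inr (Or.inr (Or.inr (Or.inl ⟨_, List.mem_cons_self, _,
          List.mem_cons_of_mem _ List.mem_cons_self, rfl, ?_⟩))))
      rw [termCode_addT, realize_add]
    | mul t s h h' =>
      refine .intro [_, _] _ (List.forall_mem_cons.2 ⟨h, List.forall_mem_singleton.2 h'⟩)
        (Or.inr (Or.inr (Or.inr (Or.inr ⟨_, List.mem_cons_self, _,
          List.mem_cons_of_mem _ List.mem_cons_self, rfl, ?_⟩))))
      rw [termCode_mulT, realize_mul]

@[fun_prop]
theorem sigmaPred_termVal : SigmaPred 1 TermVal :=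
  sigmaPred_termVal_of_primrec (f := Nat.succ) (g := fun x => x.1 + x.2) (h := fun x => x.1 * x.2)
    Primrec.succ (by fun_prop) (by fun_prop) (fun _ => rfl) (fun _ => rfl) (fun _ => rfl)
    fun _ => rfl

/-- `x = (k, t)` where `t` codes a term in the context `k`. -/
def IsTermCode (x : ℕ × List ℕ) : Prop :=
  ∃ (k : ℕ) (t : LA.Term (Empty ⊕ Fin k)), x = (k, termCode t)

@[fun_prop]
theorem sigmaPred_isTermCode : SigmaPred 1 IsTermCode := by
  have : SigmaPred 1 fun x : ℕ × List ℕ =>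
      ∃ (l : List ℕ) (m : ℕ), l.length = x.1 ∧ TermVal (x.2, l, m) := by fun_prop
  refine this.of_iff fun x => ⟨?_, ?_⟩
  · rintro ⟨k, t, rfl⟩
    exact ⟨List.ofFn fun _ => 0, _, List.length_ofFn, k, t, _, rfl⟩
  · rintro ⟨l, m, h, k, t, v, hx⟩
    obtain ⟨h₁, h₂, -⟩ := by simpa using hx
    refine ⟨k, t, ?_⟩
    rw [← h₁, ← List.length_ofFn (f := v), ← h₂, h]

/-- `x = (k, c)` where `c` codes a formula in the context `k`. -/
def IsFormCode (x : ℕ × List ℕ) : Prop :=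
  ∃ (k : ℕ) (φ : LA.BoundedFormula Empty k), x = (k, formCode φ)

@[fun_prop]
theorem sigmaPred_isFormCode : SigmaPred 1 IsFormCode := by
  refine SigmaPred.of_generated (n := 0) (step := fun p =>
    p.2.2 = botC p.2.1 ∨
    (∃ t s, IsTermCode (p.2.1, t) ∧ IsTermCode (p.2.1, s) ∧
      (p.2.2 = eqC p.2.1 t s ∨ p.2.2 = leC p.2.1 t s)) ∨
    (∃ y ∈ p.1, ∃ z ∈ p.1, y.1 = z.1 ∧ p.2 = (y.1, impC y.2 z.2)) ∨
    (∃ c, (p.2.1 + 1, c) ∈ p.1 ∧ p.2.2 = allC c))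
    (by fun_prop) ?_ ?_ ?_
  · intro D D' a h
    grind
  · rintro D ⟨k, c⟩ hD h
    dsimp only at h
    rcases h with rfl | ⟨t, s, ht, hs, h⟩ | ⟨y, hy, z, hz, hyz, h⟩ | ⟨c', hc, rfl⟩
    · exact ⟨k, ⊥, by rw [formCode_bot]⟩
    · obtain ⟨k, t, ht⟩ := ht
      obtain ⟨k', s, hs⟩ := hs
      cases ht
      cases hs
      rcases h with rfl | rfl
      · exact ⟨k, t =' s, by rw [formCode_equal]⟩
      · exact ⟨k, leF t s, by rw [formCode_leF]⟩
    · obtain ⟨k, φ, rfl⟩ := hD _ hy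
      obtain ⟨k', ψ, rfl⟩ := hD _ hz
      cases hyz
      exact ⟨k, φ ⟹ ψ, by rw [formCode_imp]; exact h⟩
    · obtain ⟨k', φ, h⟩ := hD _ hc
      cases h
      exact ⟨k, φ.all, rfl⟩
  · rintro _ ⟨k, φ, rfl⟩
    induction φ using form_induction with
    | falsum k => exact .intro [] _ (by simp) (Or.inl formCode_bot)
    | equal k t s =>
      exact .intro [] _ (by simp) (Or.inr (Or.inl
        ⟨_, _, ⟨k, t, rfl⟩, ⟨k, s, rfl⟩, Or.inl (formCode_equal t s)⟩))
    | le k t s =>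
      exact .intro [] _ (by simp) (Or.inr (Or.inl
        ⟨_, _, ⟨k, t, rfl⟩, ⟨k, s, rfl⟩, Or.inr (formCode_leF t s)⟩))
    | imp k φ ψ h h' =>
      exact .intro [_, _] _ (List.forall_mem_cons.2 ⟨h, List.forall_mem_singleton.2 h'⟩)
        (Or.inr (Or.inr (Or.inl ⟨_, List.mem_cons_self, _,
          List.mem_cons_of_mem _ List.mem_cons_self, rfl, by rw [formCode_imp]⟩)))
    | all k φ h =>
      exact .intro [_] _ (List.forall_mem_singleton.2 h)
        (Or.inr (Or.inr (Or.inr ⟨_, List.mem_cons_self, rfl⟩)))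

/-- The formula `φ` has the truth value `b` in `ℕ`. -/
def Holds (b : Bool) {k : ℕ} (φ : LA.BoundedFormula Empty k) (v : Fin k → ℕ) : Prop :=
  φ.Realize (fun e => Empty.elim e) v ↔ b = true

/-- `x = (b, c, l)` where `c` codes a formula in the class `P b` with truth value `b` under `l`. -/
def Val (P : Bool → ∀ k, LA.BoundedFormula Empty k → Prop) (x : Bool × List ℕ × List ℕ) : Prop :=
  ∃ (k : ℕ) (φ : LA.BoundedFormula Empty k) (v : Fin k → ℕ),
    x.2 = (formCode φ, List.ofFn v) ∧ P x.1 k φ ∧ Holds x.1 φ v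

section

variable {α : Type} [Primcodable α]

@[fun_prop]
theorem primrec_beq {f g : α → ℕ} (hf : Primrec f) (hg : Primrec g) :
    Primrec fun a => Nat.beq (f a) (g a) :=
  (Primrec.eq.comp hf hg).decide.of_eq fun a => by
    rw [Bool.eq_iff_iff, decide_eq_true_iff, Nat.beq_eq]

@[fun_prop]
theorem primrec_ble {f g : α → ℕ} (hf : Primrec f) (hg : Primrec g) :
    Primrec fun a => Nat.ble (f a) (g a) :=
  (Primrec.nat_le.comp hf hg).decide.of_eq fun a => by
    rw [Bool.eq_iff_iff, decide_eq_true_iff, Nat.ble_eq]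

@[fun_prop]
theorem primrec_or {f g : α → Bool} (hf : Primrec f) (hg : Primrec g) :
    Primrec fun a => (f a || g a) := Primrec.or.comp hf hg

@[fun_prop]
theorem primrec_not {f : α → Bool} (hf : Primrec f) : Primrec fun a => !f a :=
  Primrec.not.comp hf

@[fun_prop]
theorem primrec_cond {β : Type} [Primcodable β] {c : α → Bool} {f g : α → β} (hc : Primrec c)
    (hf : Primrec f) (hg : Primrec g) : Primrec fun a => cond (c a) (f a) (g a) :=
  Primrec.cond hc hf hg

end

theorem ofFn_snoc {α : Type} {k : ℕ} (v : Fin k → α) (a : α) :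
    List.ofFn (Fin.snoc v a : Fin (k + 1) → α) = List.ofFn v ++ [a] := by
  rw [List.ofFn_succ']
  simp

theorem exists_ofFn {α : Type} (l : List α) : ∃ (k : ℕ) (v : Fin k → α), l = List.ofFn v :=
  ⟨l.length, l.get, (List.ofFn_get l).symm⟩

theorem termVal_ofFn [LA.Structure ℕ] {k : ℕ} {t : List ℕ} {v : Fin k → ℕ} {m : ℕ} :
    TermVal (t, List.ofFn v, m) ↔ ∃ s : LA.Term (Empty ⊕ Fin k),
      t = termCode s ∧ m = s.realize (Sum.elim (fun e => Empty.elim e) v) := by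
  constructor
  · rintro ⟨k', s, v', h⟩
    obtain ⟨h₁, h₂, h₃⟩ := by simpa only [Prod.mk.injEq] using h
    cases List.ofFn_inj'.1 h₂
    exact ⟨s, h₁, h₃⟩
  · rintro ⟨s, rfl, rfl⟩
    exact ⟨k, s, v, rfl⟩

theorem formCode_inj {k : ℕ} {φ ψ : LA.BoundedFormula Empty k} :
    formCode φ = formCode ψ ↔ φ = ψ := by
  refine ⟨fun h => ?_, fun h => h ▸ rfl⟩
  cases formCode_injective h
  rfl

section

variable {P : Bool → ∀ k, LA.BoundedFormula Empty k → Prop} {k : ℕ} {b : Bool} {c : List ℕ}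
  {v : Fin k → ℕ}

theorem val_ofFn : Val P (b, c, List.ofFn v) ↔
    ∃ φ : LA.BoundedFormula Empty k, c = formCode φ ∧ P b k φ ∧ Holds b φ v := by
  constructor
  · rintro ⟨k', φ, v', h, h'⟩
    obtain ⟨h₁, h₂⟩ := by simpa only [Prod.mk.injEq] using h
    cases List.ofFn_inj'.1 h₂
    exact ⟨φ, h₁, h'⟩
  · rintro ⟨φ, rfl, h⟩
    exact ⟨k, φ, v, rfl, h⟩

theorem val_snoc {a : ℕ} : Val P (b, c, List.ofFn v ++ [a]) ↔
    ∃ φ : LA.BoundedFormula Empty (k + 1), c = formCode φ ∧ P b (k + 1) φ ∧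
      Holds b φ (Fin.snoc v a) := by
  rw [← ofFn_snoc, val_ofFn]

theorem exists_of_forall_val {m : ℕ} (h : ∀ a < m + 1, Val P (b, c, List.ofFn v ++ [a])) :
    ∃ φ : LA.BoundedFormula Empty (k + 1), c = formCode φ ∧ P b (k + 1) φ ∧
      ∀ a < m + 1, Holds b φ (Fin.snoc v a) := by
  obtain ⟨φ, rfl, h₁, -⟩ := val_snoc.1 (h 0 m.succ_pos)
  refine ⟨φ, rfl, h₁, fun a ha => ?_⟩
  obtain ⟨ψ, h₂, -, h₃⟩ := val_snoc.1 (h a ha)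
  rwa [formCode_inj.1 h₂]

end

theorem holds_bdall {k : ℕ} (t : LA.Term (Empty ⊕ Fin k)) (φ : LA.BoundedFormula Empty (k + 1))
    (v : Fin k → ℕ) : Holds true ((leF (&(Fin.last k)) (liftT t) ⟹ φ).all) v ↔
      ∀ a < t.realize (Sum.elim (fun e => Empty.elim e) v) + 1, Holds true φ (Fin.snoc v a) := by
  simp only [Holds, realize_bdall, leIn_nat, Nat.lt_succ_iff, iff_true]

theorem holds_bdall_false {k : ℕ} (t : LA.Term (Empty ⊕ Fin k))
    (φ : LA.BoundedFormula Empty (k + 1)) (v : Fin k → ℕ) :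
    Holds false ((leF (&(Fin.last k)) (liftT t) ⟹ φ).all) v ↔
      ∃ a < t.realize (Sum.elim (fun e => Empty.elim e) v) + 1, Holds false φ (Fin.snoc v a) := by
  simp only [Holds, realize_bdall, leIn_nat, Nat.lt_succ_iff, Bool.false_eq_true, iff_false,
    not_forall, exists_prop]

theorem holds_realize {k : ℕ} (φ : LA.BoundedFormula Empty k) (v : Fin k → ℕ) :
    ∃ b, Holds b φ v := by
  by_cases h : φ.Realize (fun e => Empty.elim e) v
  · exact ⟨true, by simp [Holds, h]⟩
  · exact ⟨false, by simp [Holds, h]⟩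

@[fun_prop]
theorem sigmaPred_val_delta0 : SigmaPred 1 (Val fun _ _ => Delta0) := by
  refine SigmaPred.of_generated (n := 0) (step := fun p =>
    (p.2.1 = false ∧ p.2.2.1 = botC p.2.2.2.length) ∨
    (∃ t s m m', TermVal (t, p.2.2.2, m) ∧ TermVal (s, p.2.2.2, m') ∧
      ((p.2.2.1 = eqC p.2.2.2.length t s ∧ p.2.1 = Nat.beq m m') ∨
        (p.2.2.1 = leC p.2.2.2.length t s ∧ p.2.1 = Nat.ble m m'))) ∨
    (∃ y ∈ p.1, ∃ z ∈ p.1, y.2.2 = z.2.2 ∧ p.2 = (!y.1 || z.1, impC y.2.1 z.2.1, y.2.2)) ∨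
    (∃ t m c, TermVal (t, p.2.2.2, m) ∧ p.2.2.1 = bdallC p.2.2.2.length t c ∧
      ((p.2.1 = true ∧ ∀ a < m + 1, (true, c, p.2.2.2 ++ [a]) ∈ p.1) ∨
        (p.2.1 = false ∧ ∃ a, a < m + 1 ∧ (false, c, p.2.2.2 ++ [a]) ∈ p.1))))
    (by fun_prop) ?_ ?_ ?_
  · intro D D' a h
    grind
  · rintro D ⟨b, c, l⟩ hD h
    obtain ⟨k, v, rfl⟩ := exists_ofFn l
    dsimp only at h
    rw [List.length_ofFn] at h
    rw [val_ofFn]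
    rcases h with ⟨rfl, rfl⟩ | ⟨t, s, m, m', ht, hs, h⟩ | ⟨y, hy, z, hz, hyz, h⟩ |
      ⟨t, m, c', ht, rfl, h⟩
    · exact ⟨⊥, formCode_bot.symm, .falsum, by simp [Holds]⟩
    · obtain ⟨t, rfl, rfl⟩ := termVal_ofFn.1 ht
      obtain ⟨s, rfl, rfl⟩ := termVal_ofFn.1 hs
      rcases h with ⟨rfl, rfl⟩ | ⟨rfl, rfl⟩
      · exact ⟨t =' s, (formCode_equal t s).symm, .equal t s, by simp [Holds]⟩
      · exact ⟨leF t s, (formCode_leF t s).symm, .le t s, by simp [Holds, realize_leF, leIn_nat]⟩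
    · obtain ⟨b₁, c₁, l₁⟩ := y
      obtain ⟨b₂, c₂, l₂⟩ := z
      simp only [Prod.mk.injEq] at h hyz
      obtain ⟨rfl, rfl, rfl⟩ := h
      subst hyz
      obtain ⟨φ, rfl, h₁, h₂⟩ := val_ofFn.1 (hD _ hy)
      obtain ⟨ψ, rfl, h₃, h₄⟩ := val_ofFn.1 (hD _ hz)
      refine ⟨φ ⟹ ψ, (formCode_imp φ ψ).symm, h₁.imp h₃, ?_⟩
      simp only [Holds, realize_imp] at h₂ h₄ ⊢
      rw [h₂, h₄]
      cases b₁ <;> simp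
    · obtain ⟨t, rfl, rfl⟩ := termVal_ofFn.1 ht
      rcases h with ⟨rfl, h⟩ | ⟨rfl, a, ha, h⟩
      · obtain ⟨φ, rfl, h₁, h₂⟩ := exists_of_forall_val fun a ha => hD _ (h a ha)
        exact ⟨_, (formCode_bdall t φ).symm, h₁.bdall t, (holds_bdall t φ v).2 h₂⟩
      · obtain ⟨φ, rfl, h₁, h₂⟩ := val_snoc.1 (hD _ h)
        exact ⟨_, (formCode_bdall t φ).symm, h₁.bdall t, (holds_bdall_false t φ v).2 ⟨a, ha, h₂⟩⟩
  · rintro ⟨b, c, l⟩ ⟨k, φ, v, h, hφ, hb⟩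
    dsimp only at h hφ hb
    cases h
    induction hφ generalizing b with
    | falsum =>
      refine .intro [] _ (by simp) (Or.inl ⟨?_, ?_⟩)
      · simpa [Holds] using hb
      · simp [formCode_bot]
    | equal t s =>
      refine .intro [] _ (by simp) (Or.inr (Or.inl ⟨_, _, _, _, termVal_ofFn.2 ⟨t, rfl, rfl⟩,
        termVal_ofFn.2 ⟨s, rfl, rfl⟩, Or.inl ⟨?_, ?_⟩⟩))
      · simp [formCode_equal]
      · rw [Bool.eq_iff_iff, Nat.beq_eq]
        exact (Iff.symm hb).trans (by simp)
    | le t s =>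
      refine .intro [] _ (by simp) (Or.inr (Or.inl ⟨_, _, _, _, termVal_ofFn.2 ⟨t, rfl, rfl⟩,
        termVal_ofFn.2 ⟨s, rfl, rfl⟩, Or.inr ⟨?_, ?_⟩⟩))
      · simp [formCode_leF]
      · rw [Bool.eq_iff_iff, Nat.ble_eq]
        exact (Iff.symm hb).trans (by simp [realize_leF, leIn_nat])
    | @imp k φ ψ h₁ h₂ ih₁ ih₂ =>
      obtain ⟨b₁, hb₁⟩ := holds_realize φ v
      obtain ⟨b₂, hb₂⟩ := holds_realize ψ v
      refine .intro [_, _] _ (List.forall_mem_cons.2 ⟨ih₁ b₁ v hb₁,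
        List.forall_mem_singleton.2 (ih₂ b₂ v hb₂)⟩) (Or.inr (Or.inr (Or.inl
          ⟨_, List.mem_cons_self, _, List.mem_cons_of_mem _ List.mem_cons_self, rfl, ?_⟩)))
      simp only [Holds, realize_imp] at hb₁ hb₂ hb
      rw [hb₁, hb₂] at hb
      rw [formCode_imp, Prod.mk.injEq]
      exact ⟨by revert hb; cases b <;> cases b₁ <;> simp, rfl⟩
    | @bdall k t φ h ih =>
      cases b
      · obtain ⟨a, ha, h'⟩ := (holds_bdall_false t φ v).1 hb
        refine .intro [_] _ (List.forall_mem_singleton.2 (ih false (Fin.snoc v a) h'))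
          (Or.inr (Or.inr (Or.inr ⟨_, _, formCode φ, termVal_ofFn.2 ⟨t, rfl, rfl⟩, ?_,
            Or.inr ⟨rfl, a, ha, ?_⟩⟩)))
        · rw [formCode_bdall, List.length_ofFn]
        · rw [ofFn_snoc]
          exact List.mem_cons_self
      · have h' := (holds_bdall t φ v).1 hb
        refine .intro ((List.range _).map fun a => (true, formCode φ, List.ofFn v ++ [a])) _ ?_
          (Or.inr (Or.inr (Or.inr ⟨_, _, formCode φ, termVal_ofFn.2 ⟨t, rfl, rfl⟩, ?_,
            Or.inl ⟨rfl, fun a ha => List.mem_map_of_mem (List.mem_range.2 ha)⟩⟩)))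
        · intro d hd
          obtain ⟨a, ha, rfl⟩ := List.mem_map.1 hd
          rw [← ofFn_snoc]
          exact ih _ _ (h' a (List.mem_range.1 ha))
        · rw [formCode_bdall, List.length_ofFn]

end Truth

section Classes

variable {k n : ℕ} {b : Bool}

/-- `φ` belongs to `Σₙ` (for `b = true`) or to `Πₙ` (for `b = false`). -/
def InClass (b : Bool) (n : ℕ) {k : ℕ} (φ : LA.BoundedFormula Empty k) : Prop :=
  cond b (IsSigma n φ) (IsPi n φ)

/-- The quantifier under which the class `b` is closed. -/
def quantF (b : Bool) (φ : LA.BoundedFormula Empty (k + 1)) : LA.BoundedFormula Empty k :=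
  cond b φ.ex φ.all

/-- Conjunction (for `b = true`) or disjunction (for `b = false`). -/
def junctF (b : Bool) (φ ψ : LA.BoundedFormula Empty k) : LA.BoundedFormula Empty k :=
  cond b (φ ⊓ ψ) (φ ⊔ ψ)

/-- The bounded quantifier which is dual to `quantF b`. -/
def boundF (b : Bool) (t : LA.Term (Empty ⊕ Fin k)) (φ : LA.BoundedFormula Empty (k + 1)) :
    LA.BoundedFormula Empty k :=
  cond b (leF (&(Fin.last k)) (liftT t) ⟹ φ).all (leF (&(Fin.last k)) (liftT t) ⊓ φ).ex

def quantC (b : Bool) (k : ℕ) (c : List ℕ) : List ℕ := cond b (exC k c) (allC c)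
def junctC (b : Bool) (k : ℕ) (c d : List ℕ) : List ℕ := cond b (infC k c d) (supC k c d)
def boundC (b : Bool) (k : ℕ) (t c : List ℕ) : List ℕ := cond b (bdallC k t c) (bdexC k t c)

theorem formCode_quantF (φ : LA.BoundedFormula Empty (k + 1)) :
    formCode (quantF b φ) = quantC b k (formCode φ) := by
  cases b
  · exact formCode_all φ
  · exact formCode_ex φ

theorem formCode_junctF (φ ψ : LA.BoundedFormula Empty k) :
    formCode (junctF b φ ψ) = junctC b k (formCode φ) (formCode ψ) := by
  cases b
  · exact formCode_sup φ ψ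
  · exact formCode_inf φ ψ

theorem formCode_boundF (t : LA.Term (Empty ⊕ Fin k)) (φ : LA.BoundedFormula Empty (k + 1)) :
    formCode (boundF b t φ) = boundC b k (termCode t) (formCode φ) := by
  cases b
  · exact formCode_bdex t φ
  · exact formCode_bdall t φ

theorem holds_quantF (φ : LA.BoundedFormula Empty (k + 1)) (v : Fin k → ℕ) :
    Holds b (quantF b φ) v ↔ ∃ a, Holds b φ (Fin.snoc v a) := by
  cases b <;> simp [Holds, quantF]

theorem holds_junctF (φ ψ : LA.BoundedFormula Empty k) (v : Fin k → ℕ) :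
    Holds b (junctF b φ ψ) v ↔ Holds b φ v ∧ Holds b ψ v := by
  cases b <;> simp [Holds, junctF]

theorem holds_junctF_not (φ ψ : LA.BoundedFormula Empty k) (v : Fin k → ℕ) :
    Holds b (junctF (!b) φ ψ) v ↔ Holds b φ v ∨ Holds b ψ v := by
  cases b
  · simp [Holds, junctF, imp_iff_not_or]
  · simp [Holds, junctF]

theorem holds_boundF (t : LA.Term (Empty ⊕ Fin k)) (φ : LA.BoundedFormula Empty (k + 1))
    (v : Fin k → ℕ) : Holds b (boundF b t φ) v ↔
      ∀ a < t.realize (Sum.elim (fun e => Empty.elim e) v) + 1, Holds b φ (Fin.snoc v a) := by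
  cases b
  · simp only [Holds, boundF, cond_false, realize_bdex, leIn_nat, Nat.lt_succ_iff,
      Bool.false_eq_true, iff_false, not_exists, not_and]
  · exact holds_bdall t φ v

theorem InClass.quantF {φ : LA.BoundedFormula Empty (k + 1)} (h : InClass b (n + 1) φ) :
    InClass b (n + 1) (quantF b φ) := by
  cases b
  · exact IsPi.all h
  · exact IsSigma.ex h

theorem InClass.junctF {b' : Bool} {φ ψ : LA.BoundedFormula Empty k} (h : InClass b (n + 1) φ)
    (h' : InClass b (n + 1) ψ) : InClass b (n + 1) (junctF b' φ ψ) := by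
  cases b <;> cases b'
  · exact IsPi.sup h h'
  · exact IsPi.inf h h'
  · exact IsSigma.sup h h'
  · exact IsSigma.inf h h'

theorem InClass.boundF {φ : LA.BoundedFormula Empty (k + 1)} (t : LA.Term (Empty ⊕ Fin k))
    (h : InClass b (n + 1) φ) : InClass b (n + 1) (boundF b t φ) := by
  cases b
  · exact IsPi.bdex t h
  · exact IsSigma.bdall t h

theorem InClass.succ {φ : LA.BoundedFormula Empty k} (h : InClass (!b) n φ) :
    InClass b (n + 1) φ := by
  cases b
  · exact IsPi.ofSigma h
  · exact IsSigma.ofPi h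

theorem inClass_zero {φ : LA.BoundedFormula Empty k} : InClass b 0 φ ↔ Delta0 φ := by
  cases b
  · exact ⟨fun h => by cases h; assumption, .ofDelta0⟩
  · exact ⟨fun h => by cases h; assumption, .ofDelta0⟩

theorem inClass_induction {C : Bool → ℕ → ∀ k, LA.BoundedFormula Empty k → Prop}
    (delta : ∀ b k φ, Delta0 φ → C b 0 k φ)
    (low : ∀ b n k φ, InClass (!b) n φ → C (!b) n k φ → C b (n + 1) k φ)
    (quant : ∀ b n k φ, InClass b (n + 1) φ → C b (n + 1) (k + 1) φ →
      C b (n + 1) k (quantF b φ))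
    (junct : ∀ b n b' k φ ψ, InClass b (n + 1) φ → InClass b (n + 1) ψ → C b (n + 1) k φ →
      C b (n + 1) k ψ → C b (n + 1) k (junctF b' φ ψ))
    (bound : ∀ b n k t φ, InClass b (n + 1) φ → C b (n + 1) (k + 1) φ →
      C b (n + 1) k (boundF b t φ))
    {b : Bool} {n k : ℕ} {φ : LA.BoundedFormula Empty k} (h : InClass b n φ) : C b n k φ := by
  cases b
  · exact IsPi.rec (motive_1 := fun n k φ _ => C true n k φ)
      (motive_2 := fun n k φ _ => C false n k φ)
      (fun h => delta _ _ _ h) (fun h ih => low _ _ _ _ h ih) (fun h ih => quant _ _ _ _ h ih)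
      (fun h h' ih ih' => junct _ _ true _ _ _ h h' ih ih')
      (fun h h' ih ih' => junct _ _ false _ _ _ h h' ih ih')
      (fun t _ h ih => bound _ _ _ t _ h ih)
      (fun h => delta _ _ _ h) (fun h ih => low _ _ _ _ h ih) (fun h ih => quant _ _ _ _ h ih)
      (fun h h' ih ih' => junct _ _ true _ _ _ h h' ih ih')
      (fun h h' ih ih' => junct _ _ false _ _ _ h h' ih ih')
      (fun t _ h ih => bound _ _ _ t _ h ih) h
  · exact IsSigma.rec (motive_1 := fun n k φ _ => C true n k φ)
      (motive_2 := fun n k φ _ => C false n k φ)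
      (fun h => delta _ _ _ h) (fun h ih => low _ _ _ _ h ih) (fun h ih => quant _ _ _ _ h ih)
      (fun h h' ih ih' => junct _ _ true _ _ _ h h' ih ih')
      (fun h h' ih ih' => junct _ _ false _ _ _ h h' ih ih')
      (fun t _ h ih => bound _ _ _ t _ h ih)
      (fun h => delta _ _ _ h) (fun h ih => low _ _ _ _ h ih) (fun h ih => quant _ _ _ _ h ih)
      (fun h h' ih ih' => junct _ _ true _ _ _ h h' ih ih')
      (fun h h' ih ih' => junct _ _ false _ _ _ h h' ih ih')
      (fun t _ h ih => bound _ _ _ t _ h ih) h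

section

variable {α : Type} [Primcodable α]

@[fun_prop]
theorem primrec_quantC {b : α → Bool} {k : α → ℕ} {c : α → List ℕ} (hb : Primrec b)
    (hk : Primrec k) (hc : Primrec c) : Primrec fun a => quantC (b a) (k a) (c a) := by
  unfold quantC
  fun_prop

@[fun_prop]
theorem primrec_junctC {b : α → Bool} {k : α → ℕ} {c d : α → List ℕ} (hb : Primrec b)
    (hk : Primrec k) (hc : Primrec c) (hd : Primrec d) :
    Primrec fun a => junctC (b a) (k a) (c a) (d a) := by
  unfold junctC
  fun_prop

@[fun_prop]
theorem primrec_boundC {b : α → Bool} {k : α → ℕ} {t c : α → List ℕ} (hb : Primrec b)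
    (hk : Primrec k) (ht : Primrec t) (hc : Primrec c) :
    Primrec fun a => boundC (b a) (k a) (t a) (c a) := by
  unfold boundC
  fun_prop

end

/-- `x = (b, n, k, c)` where `c` codes a formula in the context `k` in the class `Σₙ` or `Πₙ`. -/
def IsClassCode (x : Bool × ℕ × ℕ × List ℕ) : Prop :=
  ∃ φ : LA.BoundedFormula Empty x.2.2.1, x.2.2.2 = formCode φ ∧ InClass x.1 x.2.1 φ

@[fun_prop]
theorem sigmaPred_isClassCode : SigmaPred 1 IsClassCode := by
  refine SigmaPred.of_generated (n := 0) (step := fun p =>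
    (p.2.2.1 = 0 ∧ ∃ b l, l.length = p.2.2.2.1 ∧ Val (fun _ _ => Delta0) (b, p.2.2.2.2, l)) ∨
    ∃ n, p.2.2.1 = n + 1 ∧ ((!p.2.1, n, p.2.2.2) ∈ p.1 ∨
      (∃ c, (p.2.1, n + 1, p.2.2.2.1 + 1, c) ∈ p.1 ∧
        p.2.2.2.2 = quantC p.2.1 p.2.2.2.1 c) ∨
      (∃ b c d, (p.2.1, n + 1, p.2.2.2.1, c) ∈ p.1 ∧ (p.2.1, n + 1, p.2.2.2.1, d) ∈ p.1 ∧
        p.2.2.2.2 = junctC b p.2.2.2.1 c d) ∨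
      (∃ t c, IsTermCode (p.2.2.2.1, t) ∧ (p.2.1, n + 1, p.2.2.2.1 + 1, c) ∈ p.1 ∧
        p.2.2.2.2 = boundC p.2.1 p.2.2.2.1 t c)))
    (by fun_prop) ?_ ?_ ?_
  · intro D D' a h
    grind
  · rintro D ⟨b, n, k, c⟩ hD h
    dsimp only at h
    rcases h with ⟨rfl, b', l, hl, h⟩ | ⟨n, rfl, h | ⟨c', h, rfl⟩ | ⟨b', c₁, c₂, h, h', rfl⟩ |
      ⟨t, c', ⟨k', s, hs⟩, h, rfl⟩⟩
    · subst hl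
      rw [← List.ofFn_get l, val_ofFn] at h
      obtain ⟨φ, rfl, hφ, -⟩ := h
      exact ⟨φ, rfl, inClass_zero.2 hφ⟩
    · obtain ⟨φ, hc, hφ⟩ := hD _ h
      exact ⟨φ, hc, InClass.succ hφ⟩
    · obtain ⟨φ, hc, hφ⟩ := hD _ h
      dsimp only at φ hc hφ
      subst hc
      exact ⟨_, (formCode_quantF φ).symm, hφ.quantF⟩
    · obtain ⟨φ, hc, hφ⟩ := hD _ h
      obtain ⟨ψ, hd, hψ⟩ := hD _ h'
      dsimp only at φ hc hφ ψ hd hψ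
      subst hc hd
      exact ⟨_, (formCode_junctF φ ψ).symm, hφ.junctF hψ⟩
    · obtain ⟨φ, hc, hφ⟩ := hD _ h
      dsimp only at φ hc hφ
      subst hc
      cases hs
      exact ⟨_, (formCode_boundF s φ).symm, hφ.boundF s⟩
  · rintro ⟨b, n, k, c⟩ ⟨φ, hc, hφ⟩
    dsimp only at φ hc hφ
    subst hc
    refine inClass_induction (C := fun b n k φ => Generated _ (b, n, k, formCode φ))
      ?_ ?_ ?_ ?_ ?_ hφ
    · intro b k φ h
      obtain ⟨b', hb'⟩ := holds_realize φ 0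
      exact .intro [] _ (by simp) (Or.inl ⟨rfl, b', List.ofFn 0, List.length_ofFn,
        val_ofFn.2 ⟨φ, rfl, h, hb'⟩⟩)
    · intro b n k φ _ ih
      exact .intro [_] _ (List.forall_mem_singleton.2 ih)
        (Or.inr ⟨n, rfl, Or.inl List.mem_cons_self⟩)
    · intro b n k φ _ ih
      exact .intro [_] _ (List.forall_mem_singleton.2 ih)
        (Or.inr ⟨n, rfl, Or.inr (Or.inl ⟨_, List.mem_cons_self, formCode_quantF φ⟩)⟩)
    · intro b n b' k φ ψ _ _ ih ih'
      exact .intro [_, _] _ (List.forall_mem_cons.2 ⟨ih, List.forall_mem_singleton.2 ih'⟩)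
        (Or.inr ⟨n, rfl, Or.inr (Or.inr (Or.inl ⟨b', _, _, List.mem_cons_self,
          List.mem_cons_of_mem _ List.mem_cons_self, formCode_junctF φ ψ⟩))⟩)
    · intro b n k t φ _ ih
      exact .intro [_] _ (List.forall_mem_singleton.2 ih)
        (Or.inr ⟨n, rfl, Or.inr (Or.inr (Or.inr ⟨_, _, ⟨k, t, rfl⟩, List.mem_cons_self,
          formCode_boundF t φ⟩))⟩)

end Classes

section Truth

theorem isClassCode_length {b : Bool} {n k : ℕ} {c : List ℕ} {v : Fin k → ℕ} :
    IsClassCode (b, n, (List.ofFn v).length, c) ↔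
      ∃ φ : LA.BoundedFormula Empty k, c = formCode φ ∧ InClass b n φ := by
  rw [List.length_ofFn]
  rfl

theorem SigmaPred.val_succ {n : ℕ} (hn : SigmaPred (n + 1) (Val fun b _ => InClass (!b) n)) :
    SigmaPred (n + 1) (Val fun b _ => InClass b (n + 1)) := by
  have hT : SigmaPred (n + 1) TermVal := sigmaPred_termVal.mono (by omega)
  have hC : SigmaPred (n + 1) IsClassCode := sigmaPred_isClassCode.mono (by omega)
  refine SigmaPred.of_generated (step := fun p =>
    Val (fun b _ => InClass (!b) n) p.2 ∨
    (∃ c a, (p.2.1, c, p.2.2.2 ++ [a]) ∈ p.1 ∧ p.2.2.1 = quantC p.2.1 p.2.2.2.length c) ∨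
    (∃ c d, (p.2.1, c, p.2.2.2) ∈ p.1 ∧ (p.2.1, d, p.2.2.2) ∈ p.1 ∧
      p.2.2.1 = junctC p.2.1 p.2.2.2.length c d) ∨
    (∃ c d, IsClassCode (p.2.1, n + 1, p.2.2.2.length, c) ∧
      IsClassCode (p.2.1, n + 1, p.2.2.2.length, d) ∧
      ((p.2.1, c, p.2.2.2) ∈ p.1 ∨ (p.2.1, d, p.2.2.2) ∈ p.1) ∧
      p.2.2.1 = junctC (!p.2.1) p.2.2.2.length c d) ∨
    (∃ t m c, TermVal (t, p.2.2.2, m) ∧ (∀ a < m + 1, (p.2.1, c, p.2.2.2 ++ [a]) ∈ p.1) ∧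
      p.2.2.1 = boundC p.2.1 p.2.2.2.length t c))
    (by fun_prop) ?_ ?_ ?_
  · intro D D' a h
    grind
  · rintro D ⟨b, c, l⟩ hD h
    obtain ⟨k, v, rfl⟩ := exists_ofFn l
    dsimp only at h
    simp only [isClassCode_length] at h
    rw [List.length_ofFn] at h
    rw [val_ofFn]
    rcases h with h | ⟨c, a, h, rfl⟩ | ⟨c, d, h, h', rfl⟩ | ⟨c, d, hc, hd, h, rfl⟩ |
      ⟨t, m, c, ht, h, rfl⟩
    · obtain ⟨φ, rfl, h, h'⟩ := val_ofFn.1 h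
      exact ⟨φ, rfl, h.succ, h'⟩
    · obtain ⟨φ, rfl, h, h'⟩ := val_snoc.1 (hD _ h)
      exact ⟨_, (formCode_quantF φ).symm, h.quantF, (holds_quantF φ v).2 ⟨a, h'⟩⟩
    · obtain ⟨φ, rfl, h₁, h₂⟩ := val_ofFn.1 (hD _ h)
      obtain ⟨ψ, rfl, h₃, h₄⟩ := val_ofFn.1 (hD _ h')
      exact ⟨_, (formCode_junctF φ ψ).symm, h₁.junctF h₃, (holds_junctF φ ψ v).2 ⟨h₂, h₄⟩⟩
    · obtain ⟨φ, rfl, hφ⟩ := hc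
      obtain ⟨ψ, rfl, hψ⟩ := hd
      refine ⟨_, (formCode_junctF φ ψ).symm, hφ.junctF hψ, (holds_junctF_not φ ψ v).2 ?_⟩
      rcases h with h | h
      · obtain ⟨φ', he, -, h'⟩ := val_ofFn.1 (hD _ h)
        rw [formCode_inj.1 he]
        exact Or.inl h'
      · obtain ⟨φ', he, -, h'⟩ := val_ofFn.1 (hD _ h)
        rw [formCode_inj.1 he]
        exact Or.inr h'
    · obtain ⟨t, rfl, rfl⟩ := termVal_ofFn.1 ht
      obtain ⟨φ, rfl, h₁, h₂⟩ := exists_of_forall_val fun a ha => hD _ (h a ha)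
      exact ⟨_, (formCode_boundF t φ).symm, h₁.boundF t, (holds_boundF t φ v).2 h₂⟩
  · rintro ⟨b, c, l⟩ ⟨k, φ, v, h, hφ, hb⟩
    dsimp only at h hφ hb
    cases h
    refine inClass_induction (C := fun b m k φ => m = n + 1 → ∀ v : Fin k → ℕ, Holds b φ v →
      Generated _ (b, formCode φ, List.ofFn v)) ?_ ?_ ?_ ?_ ?_ hφ rfl v hb
    · rintro b k φ - ⟨⟩
    · rintro b m k φ h - ⟨⟩ v hv
      exact .intro [] _ (by simp) (Or.inl (val_ofFn.2 ⟨φ, rfl, h, hv⟩))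
    · rintro b m k φ h ih ⟨⟩ v hv
      obtain ⟨a, ha⟩ := (holds_quantF φ v).1 hv
      refine .intro [_] _ (List.forall_mem_singleton.2 (ih rfl (Fin.snoc v a) ha))
        (Or.inr (Or.inl ⟨formCode φ, a, ?_, ?_⟩))
      · rw [ofFn_snoc]
        exact List.mem_cons_self
      · rw [formCode_quantF, List.length_ofFn]
    · rintro b m b' k φ ψ h h' ih ih' ⟨⟩ v hv
      rcases Bool.eq_or_eq_not b' b with rfl | rfl
      · obtain ⟨hv, hv'⟩ := (holds_junctF φ ψ v).1 hv
        refine .intro [_, _] _ (List.forall_mem_cons.2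
          ⟨ih rfl v hv, List.forall_mem_singleton.2 (ih' rfl v hv')⟩)
          (Or.inr (Or.inr (Or.inl ⟨_, _, List.mem_cons_self,
            List.mem_cons_of_mem _ List.mem_cons_self, ?_⟩)))
        rw [formCode_junctF, List.length_ofFn]
      · rcases (holds_junctF_not φ ψ v).1 hv with hv | hv
        · refine .intro [_] _ (List.forall_mem_singleton.2 (ih rfl v hv))
            (Or.inr (Or.inr (Or.inr (Or.inl ⟨_, _, isClassCode_length.2 ⟨φ, rfl, h⟩,
              isClassCode_length.2 ⟨ψ, rfl, h'⟩, Or.inl List.mem_cons_self, ?_⟩))))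
          rw [formCode_junctF, List.length_ofFn]
        · refine .intro [_] _ (List.forall_mem_singleton.2 (ih' rfl v hv))
            (Or.inr (Or.inr (Or.inr (Or.inl ⟨_, _, isClassCode_length.2 ⟨φ, rfl, h⟩,
              isClassCode_length.2 ⟨ψ, rfl, h'⟩, Or.inr List.mem_cons_self, ?_⟩))))
          rw [formCode_junctF, List.length_ofFn]
    · rintro b m k t φ h ih ⟨⟩ v hv
      have hv := (holds_boundF t φ v).1 hv
      refine .intro ((List.range _).map fun a => (b, formCode φ, List.ofFn v ++ [a])) _ ?_
        (Or.inr (Or.inr (Or.inr (Or.inr ⟨_, _, formCode φ, termVal_ofFn.2 ⟨t, rfl, rfl⟩,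
          fun a ha => List.mem_map_of_mem (List.mem_range.2 ha), ?_⟩))))
      · intro d hd
        obtain ⟨a, ha, rfl⟩ := List.mem_map.1 hd
        rw [← ofFn_snoc]
        exact ih rfl _ (hv a (List.mem_range.1 ha))
      · rw [formCode_boundF, List.length_ofFn]

theorem sigmaPred_val_low (n : ℕ) : SigmaPred (n + 1) (Val fun b _ => InClass (!b) n) := by
  induction n with
  | zero =>
    refine sigmaPred_val_delta0.of_iff fun x => ?_
    simp only [Val, inClass_zero]
  | succ n ih =>
    have hC : SigmaPred (n + 2) IsClassCode := sigmaPred_isClassCode.mono (by omega)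
    have hV : SigmaPred (n + 2) fun x => ¬ Val (fun b _ => InClass b (n + 1)) x :=
      ih.val_succ.not
    have : SigmaPred (n + 2) fun x : Bool × List ℕ × List ℕ =>
        IsClassCode (!x.1, n + 1, x.2.2.length, x.2.1) ∧
          ¬ Val (fun b _ => InClass b (n + 1)) (!x.1, x.2) :=
      .and (hC.comp (by fun_prop)) (hV.comp (by fun_prop))
    refine this.of_iff ?_
    rintro ⟨b, c, l⟩
    obtain ⟨k, v, rfl⟩ := exists_ofFn l
    dsimp only
    rw [isClassCode_length, val_ofFn, val_ofFn]
    have hb (φ : LA.BoundedFormula Empty k) : Holds b φ v ↔ ¬ Holds (!b) φ v := by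
      cases b <;> simp [Holds]
    constructor
    · rintro ⟨φ, rfl, h, h'⟩
      refine ⟨⟨φ, rfl, h⟩, ?_⟩
      rintro ⟨ψ, he, -, h''⟩
      rw [← formCode_inj.1 he] at h''
      exact (hb φ).1 h' h''
    · rintro ⟨⟨φ, rfl, h⟩, h'⟩
      exact ⟨φ, rfl, h, (hb φ).2 fun h'' => h' ⟨φ, rfl, h, h''⟩⟩

theorem realize_sentence {M : Type} [LA.Structure M] (φ : LA.Sentence) (e : Empty → M)
    (v : Fin 0 → M) : M ⊨ φ ↔ BoundedFormula.Realize φ e v := by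
  rw [Subsingleton.elim e default, Subsingleton.elim v default]
  rfl

theorem sigmaPred_sigmaTruth (n : ℕ) : SigmaPred (n + 1) fun m => m ∈ SigmaTruth (n + 1) := by
  have h := (sigmaPred_val_low n).val_succ
  have : SigmaPred (n + 1) fun m : ℕ => ∃ c : List ℕ, m = Encodable.encode c ∧
    Val (fun b _ => InClass b (n + 1)) (true, c, []) := by fun_prop
  refine this.of_iff fun m => ?_
  rw [show ([] : List ℕ) = List.ofFn (![] : Fin 0 → ℕ) from rfl]
  simp only [val_ofFn]
  constructor
  · rintro ⟨φ, h, rfl, h'⟩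
    refine ⟨_, godel_eq φ, φ, rfl, h, ?_⟩
    rw [Holds, iff_true_right rfl]
    exact (realize_sentence φ _ _).1 h'
  · rintro ⟨_, rfl, φ, rfl, h, h'⟩
    exact ⟨φ, h, godel_eq φ, (realize_sentence φ _ _).2 (h'.2 rfl)⟩

end Truth

section Names

def succN (a : ℕ) : ℕ := 4 * a + 1
def addN (a b : ℕ) : ℕ := 4 * Nat.pair a b + 2
def mulN (a b : ℕ) : ℕ := 4 * Nat.pair a b + 3
def witN (c l : List ℕ) : ℕ := 4 * Encodable.encode (c, l) + 4

/-- The natural numbers viewed as names `0`, `succN a`, `addN a b`, `mulN a b`, and `witN c l`,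
the last being a name for a counterexample to the formula coded by `c` with the parameters `l`. -/
@[reducible]
def nameStructure : LA.Structure ℕ where
  funMap {_} f := match f with
    | ArithFunc.zero => fun _ => 0
    | ArithFunc.succ => fun v => succN (v 0)
    | ArithFunc.add  => fun v => addN (v 0) (v 1)
    | ArithFunc.mul  => fun v => mulN (v 0) (v 1)
  RelMap _ _ := False

def NameVal (x : List ℕ × List ℕ × ℕ) : Prop := @TermVal nameStructure x

/-- The atomic proposition stating that the formula coded by `c` holds for the names `l`. -/
def form (c l : List ℕ) : ℕ := Encodable.encode (c, l)
def eqN (a b : ℕ) : ℕ := form (eqC 2 (varC 0) (varC 1)) [a, b]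
def leN (a b : ℕ) : ℕ := form (leC 2 (varC 0) (varC 1)) [a, b]

section

variable {α : Type} [Primcodable α] {f g : α → ℕ} {c l : α → List ℕ}

@[fun_prop]
theorem primrec_succN (hf : Primrec f) : Primrec fun a => succN (f a) := by
  unfold succN
  fun_prop

@[fun_prop]
theorem primrec_addN (hf : Primrec f) (hg : Primrec g) : Primrec fun a => addN (f a) (g a) := by
  unfold addN
  fun_prop

@[fun_prop]
theorem primrec_mulN (hf : Primrec f) (hg : Primrec g) : Primrec fun a => mulN (f a) (g a) := by
  unfold mulN
  fun_prop

@[fun_prop]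
theorem primrec_form (hc : Primrec c) (hl : Primrec l) : Primrec fun a => form (c a) (l a) :=
  Primrec.encode.comp (hc.pair hl)

@[fun_prop]
theorem primrec_witN (hc : Primrec c) (hl : Primrec l) : Primrec fun a => witN (c a) (l a) := by
  change Primrec fun a => 4 * form (c a) (l a) + 4
  fun_prop

@[fun_prop]
theorem primrec_eqN (hf : Primrec f) (hg : Primrec g) : Primrec fun a => eqN (f a) (g a) := by
  unfold eqN
  fun_prop

@[fun_prop]
theorem primrec_leN (hf : Primrec f) (hg : Primrec g) : Primrec fun a => leN (f a) (g a) := by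
  unfold leN
  fun_prop

end

@[fun_prop]
theorem sigmaPred_nameVal : SigmaPred 1 NameVal :=
  @sigmaPred_termVal_of_primrec nameStructure 0 succN (fun x => addN x.1 x.2)
    (fun x => mulN x.1 x.2) (by fun_prop) (by fun_prop) (by fun_prop) (fun _ => rfl)
    (fun _ => rfl) (fun _ => rfl) fun _ => rfl

/-- Sequents expressing that equality is a congruence. -/
def EqClause (x : List ℕ × List ℕ) : Prop :=
  ∃ a b c d, x = ([], [eqN a a]) ∨ x = ([eqN a b], [eqN b a]) ∨
    x = ([eqN a b, eqN b c], [eqN a c]) ∨ x = ([eqN a b], [eqN (succN a) (succN b)]) ∨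
    x = ([eqN a b, eqN c d], [eqN (addN a c) (addN b d)]) ∨
    x = ([eqN a b, eqN c d], [eqN (mulN a c) (mulN b d)]) ∨
    x = ([eqN a b, eqN c d, leN a c], [leN b d])

/-- Sequents expressing the meaning of atomic formulas. -/
def AtomClause (x : List ℕ × List ℕ) : Prop :=
  ∃ t s l a b, NameVal (t, l, a) ∧ NameVal (s, l, b) ∧
    (x = ([form (eqC l.length t s) l], [eqN a b]) ∨ x = ([eqN a b], [form (eqC l.length t s) l]) ∨
      x = ([form (leC l.length t s) l], [leN a b]) ∨ x = ([leN a b], [form (leC l.length t s) l]))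

/-- Sequents expressing the meaning of the propositional connectives. -/
def PropClause (x : List ℕ × List ℕ) : Prop :=
  ∃ c d l, IsFormCode (l.length, c) ∧ IsFormCode (l.length, d) ∧
    (x = ([form (botC l.length) l], []) ∨ x = ([], [form (impC c d) l, form c l]) ∨
      x = ([form d l], [form (impC c d) l]) ∨ x = ([form (impC c d) l, form c l], [form d l]))

/-- Sequents expressing the meaning of the universal quantifier. -/
def AllClause (x : List ℕ × List ℕ) : Prop :=
  ∃ c l a, IsFormCode (l.length + 1, c) ∧
    (x = ([form (allC c) l], [form c (l ++ [a])]) ∨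
      x = ([form c (l ++ [witN c l])], [form (allC c) l]))

/-- `x = (A, s)` where `s` is one of the sequents whose joint satisfiability amounts to the
existence of a model of the sentences coded in the list `A`. -/
def Clause (x : List (List ℕ) × List ℕ × List ℕ) : Prop :=
  EqClause x.2 ∨ AtomClause x.2 ∨ PropClause x.2 ∨ AllClause x.2 ∨
    ∃ c ∈ x.1, IsFormCode (0, c) ∧ x.2 = ([], [form c [] ])

@[fun_prop]
theorem sigmaPred_clause : SigmaPred 1 Clause := by
  have h₁ : SigmaPred 1 EqClause := by unfold EqClause; fun_prop
  have h₂ : SigmaPred 1 AtomClause := by unfold AtomClause; fun_prop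
  have h₃ : SigmaPred 1 PropClause := by unfold PropClause; fun_prop
  have h₄ : SigmaPred 1 AllClause := by unfold AllClause; fun_prop
  unfold Clause
  fun_prop

/-- The sequent `x` is true under the valuation `W`. -/
def Sat (W : ℕ → Prop) (x : List ℕ × List ℕ) : Prop := (∀ p ∈ x.1, W p) → ∃ p ∈ x.2, W p

end Names

section Completeness

theorem elim_comp {M : Type} {k : ℕ} (ν : ℕ → M) (v : Fin k → ℕ) :
    (fun i => ν (Sum.elim (fun e => Empty.elim e) v i)) =
      Sum.elim (fun e : Empty => Empty.elim e) fun i => ν (v i) := by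
  ext (x | i)
  · exact x.elim
  · rfl

variable {M : Type} [LA.Structure M]

theorem realize_comp_of_funMap {ν : ℕ → M}
    (hν : ∀ {n} (f : LA.Functions n) (v : Fin n → ℕ),
      Structure.funMap f (fun i => ν (v i)) = ν (nameStructure.funMap f v))
    {β : Type} (t : LA.Term β) (v : β → ℕ) :
    t.realize (fun i => ν (v i)) = ν (@Term.realize LA ℕ nameStructure _ v t) := by
  induction t with
  | var => rfl
  | func f ts ih => exact (congrArg _ (funext ih)).trans (hν f _)

theorem nameVal_ofFn {k : ℕ} {t : List ℕ} {v : Fin k → ℕ} {m : ℕ} :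
    NameVal (t, List.ofFn v, m) ↔ ∃ s : LA.Term (Empty ⊕ Fin k), t = termCode s ∧
      m = @Term.realize LA ℕ nameStructure _ (Sum.elim (fun e => Empty.elim e) v) s :=
  @termVal_ofFn nameStructure _ _ _ _

theorem isFormCode_ofFn {k j : ℕ} {v : Fin k → ℕ} {c : List ℕ} :
    IsFormCode ((List.ofFn v).length + j, c) ↔
      ∃ φ : LA.BoundedFormula Empty (k + j), c = formCode φ := by
  rw [List.length_ofFn]
  constructor
  · rintro ⟨k', φ, h⟩
    cases h
    exact ⟨φ, rfl⟩
  · rintro ⟨φ, rfl⟩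
    exact ⟨_, φ, rfl⟩

/-- The valuation given by the interpretation `ν` of names in a structure. -/
def diagram (ν : ℕ → M) (p : ℕ) : Prop :=
  ∃ (k : ℕ) (φ : LA.BoundedFormula Empty k) (v : Fin k → ℕ),
    p = form (formCode φ) (List.ofFn v) ∧ φ.Realize (fun e => Empty.elim e) fun i => ν (v i)

theorem diagram_form (ν : ℕ → M) {k : ℕ} (φ : LA.BoundedFormula Empty k) (v : Fin k → ℕ) :
    diagram ν (form (formCode φ) (List.ofFn v)) ↔
      φ.Realize (fun e => Empty.elim e) fun i => ν (v i) := by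
  constructor
  · rintro ⟨k', ψ, w, h, h'⟩
    obtain ⟨h₁, h₂⟩ := Prod.mk.inj (Encodable.encode_injective h)
    cases List.ofFn_inj'.1 h₂
    rwa [formCode_inj.1 h₁]
  · exact fun h => ⟨k, φ, v, rfl, h⟩

theorem diagram_eqN (ν : ℕ → M) (a b : ℕ) : diagram ν (eqN a b) ↔ ν a = ν b := by
  have h := diagram_form ν (k := 2) (&0 =' &1) ![a, b]
  rw [formCode_equal] at h
  exact h.trans (by simp)

theorem diagram_leN (ν : ℕ → M) (a b : ℕ) : diagram ν (leN a b) ↔ LeIn (ν a) (ν b) := by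
  have h := diagram_form ν (k := 2) (leF (&0) (&1)) ![a, b]
  rw [formCode_leF] at h
  exact h.trans (by simp [realize_leF])

theorem funMap_two (f : LA.Functions 2) (v : Fin 2 → M) :
    Structure.funMap f v = Structure.funMap f ![v 0, v 1] := by
  congr 1
  ext i
  fin_cases i <;> rfl

theorem sat_diagram {ν : ℕ → M}
    (hν : ∀ {n} (f : LA.Functions n) (v : Fin n → ℕ),
      Structure.funMap f (fun i => ν (v i)) = ν (nameStructure.funMap f v))
    (wit : ∀ (k : ℕ) (φ : LA.BoundedFormula Empty (k + 1)) (v : Fin k → ℕ),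
      φ.Realize (fun e => Empty.elim e)
        (fun i => ν ((Fin.snoc v (witN (formCode φ) (List.ofFn v)) : Fin (k + 1) → ℕ) i)) →
      φ.all.Realize (fun e => Empty.elim e) fun i => ν (v i))
    {A : List (List ℕ)} (hA : ∀ φ : LA.Sentence, formCode φ ∈ A → M ⊨ φ)
    {x : List ℕ × List ℕ} (hx : Clause (A, x)) : Sat (diagram ν) x := by
  have succ (a : ℕ) : ν (succN a) = Structure.funMap (L := LA) ArithFunc.succ fun _ => ν a :=
    (hν ArithFunc.succ fun _ => a).symm
  have add (a b : ℕ) : ν (addN a b) = Structure.funMap (L := LA) ArithFunc.add ![ν a, ν b] := by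
    refine (hν ArithFunc.add ![a, b]).symm.trans (funMap_two _ _)
  have mul (a b : ℕ) : ν (mulN a b) = Structure.funMap (L := LA) ArithFunc.mul ![ν a, ν b] := by
    refine (hν ArithFunc.mul ![a, b]).symm.trans (funMap_two _ _)
  rcases hx with ⟨a, b, c, d, h⟩ | ⟨t, s, l, a, b, ht, hs, h⟩ | ⟨c, d, l, hc, hd, h⟩ |
    ⟨c, l, a, hc, h⟩ | ⟨c, hcA, hc, h⟩
  · dsimp only at h
    rcases h with rfl | rfl | rfl | rfl | rfl | rfl | rfl <;>
      simp +contextual [Sat, diagram_eqN, diagram_leN, succ, add, mul]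
  · obtain ⟨k, v, rfl⟩ := exists_ofFn l
    obtain ⟨t, rfl, rfl⟩ := nameVal_ofFn.1 ht
    obtain ⟨s, rfl, rfl⟩ := nameVal_ofFn.1 hs
    dsimp only at h
    rw [List.length_ofFn, ← formCode_equal, ← formCode_leF] at h
    rcases h with rfl | rfl | rfl | rfl <;>
      simp only [Sat, diagram_eqN, diagram_leN, diagram_form, realize_leF,
        ← realize_comp_of_funMap hν, elim_comp, realize_bdEqual, imp_self, List.mem_singleton,
        forall_eq, exists_eq_left]
  · obtain ⟨k, v, rfl⟩ := exists_ofFn l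
    obtain ⟨φ, rfl⟩ := isFormCode_ofFn (j := 0).1 hc
    obtain ⟨ψ, rfl⟩ := isFormCode_ofFn (j := 0).1 hd
    dsimp only at h
    rw [List.length_ofFn, ← formCode_bot, ← formCode_imp] at h
    rcases h with rfl | rfl | rfl | rfl <;> simp [Sat, diagram_form] <;> tauto
  · obtain ⟨k, v, rfl⟩ := exists_ofFn l
    obtain ⟨φ, rfl⟩ := isFormCode_ofFn (j := 1).1 hc
    dsimp only at h
    rw [← formCode_all, ← ofFn_snoc, ← ofFn_snoc] at h
    rcases h with rfl | rfl <;>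
      simp only [Sat, diagram_form, List.mem_singleton, forall_eq, exists_eq_left]
    · intro h
      convert h (ν a) using 1
      ext i
      exact i.lastCases (by simp) (by simp)
    · exact wit k φ v
  · obtain ⟨φ, rfl⟩ := isFormCode_ofFn (v := ![]) (j := 0).1 hc
    dsimp only at h
    subst h
    have := (diagram_form ν φ ![]).2 ((realize_sentence φ _ _).1 (hA φ hcA))
    simpa [Sat] using this

end Completeness

section Completeness

variable {M : Type} [LA.Structure M]

open Classical in
/-- An element refuting the formula coded by `c` with the parameters `l`, if there is one. -/
noncomputable def witness [Inhabited M] (c : List ℕ) (l : List M) : M :=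
  if h : ∃ (k : ℕ) (φ : LA.BoundedFormula Empty (k + 1)) (v : Fin k → M) (a : M),
      c = formCode φ ∧ l = List.ofFn v ∧
        ¬ φ.Realize (fun e => Empty.elim e) (Fin.snoc v a : Fin (k + 1) → M) then
    h.choose_spec.choose_spec.choose_spec.choose
  else default

theorem realize_all_of_witness [Inhabited M] {k : ℕ} {φ : LA.BoundedFormula Empty (k + 1)}
    {v : Fin k → M} (h : φ.Realize (fun e => Empty.elim e)
      (Fin.snoc v (witness (formCode φ) (List.ofFn v)) : Fin (k + 1) → M)) :
    φ.all.Realize (fun e => Empty.elim e) v := by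
  intro a
  by_contra ha
  have hex : ∃ (k' : ℕ) (ψ : LA.BoundedFormula Empty (k' + 1)) (w : Fin k' → M) (a : M),
      formCode φ = formCode ψ ∧ List.ofFn v = List.ofFn w ∧
        ¬ ψ.Realize (fun e => Empty.elim e) (Fin.snoc w a : Fin (k' + 1) → M) :=
    ⟨k, φ, v, a, rfl, rfl, ha⟩
  rw [witness, dif_pos hex] at h
  obtain ⟨h₁, h₂, h₃⟩ := hex.choose_spec.choose_spec.choose_spec.choose_spec
  generalize hex.choose_spec.choose_spec.choose_spec.choose = a' at h h₃
  generalize hex.choose_spec.choose_spec.choose = w at h₂ h₃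
  generalize hex.choose_spec.choose = ψ at h₁ h₃
  generalize hex.choose = k' at w ψ h₁ h₂ h₃
  cases List.ofFn_inj'.1 h₂
  rw [formCode_inj.1 h₁] at h
  exact h₃ h

theorem lt_encode_of_mem {l : List ℕ} {a : ℕ} (h : a ∈ l) : a < Encodable.encode l := by
  induction l with
  | nil => cases h
  | cons b l ih =>
    rw [Encodable.encode_list_cons, Nat.lt_succ_iff]
    rcases List.mem_cons.1 h with rfl | h
    · exact Nat.left_le_pair _ _
    · exact (ih h).le.trans (Nat.right_le_pair _ _)

/-- The interpretation of the name `n` in terms of an interpretation of smaller names. -/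
noncomputable def interpStep [Inhabited M] (ν : ℕ → M) (n : ℕ) : M :=
  let m := (n - 1) / 4
  if n = 0 then Structure.funMap (L := LA) ArithFunc.zero ![]
  else if n % 4 = 1 then Structure.funMap (L := LA) ArithFunc.succ ![ν m]
  else if n % 4 = 2 then
    Structure.funMap (L := LA) ArithFunc.add ![ν m.unpair.1, ν m.unpair.2]
  else if n % 4 = 3 then
    Structure.funMap (L := LA) ArithFunc.mul ![ν m.unpair.1, ν m.unpair.2]
  else ((Encodable.decode (α := List ℕ × List ℕ) m).map fun x =>
    witness x.1 (x.2.map ν)).getD default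

/-- The interpretation of names in a structure. -/
noncomputable def interp (M : Type) [LA.Structure M] [Inhabited M] (n : ℕ) : M :=
  interpStep (fun m => if m < n then interp M m else default) n

variable [Inhabited M]

theorem interp_zero : interp M 0 = Structure.funMap (L := LA) ArithFunc.zero ![] := by
  rw [interp, interpStep, if_pos rfl]

theorem interp_succN (a : ℕ) :
    interp M (succN a) = Structure.funMap (L := LA) ArithFunc.succ ![interp M a] := by
  rw [interp, interpStep, if_neg (by simp [succN]), if_pos (by simp [succN])]
  have h : (succN a - 1) / 4 = a := by simp [succN]
  rw [h, if_pos (by simp only [succN]; omega)]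

theorem interp_addN (a b : ℕ) : interp M (addN a b) =
    Structure.funMap (L := LA) ArithFunc.add ![interp M a, interp M b] := by
  have ha := Nat.left_le_pair a b
  have hb := Nat.right_le_pair a b
  rw [interp, interpStep, if_neg (by simp [addN]), if_neg (by simp [addN]),
    if_pos (by simp [addN])]
  have h : (addN a b - 1) / 4 = Nat.pair a b := by simp only [addN]; omega
  rw [h, Nat.unpair_pair, if_pos (by simp only [addN]; omega), if_pos (by simp only [addN]; omega)]

theorem interp_mulN (a b : ℕ) : interp M (mulN a b) =
    Structure.funMap (L := LA) ArithFunc.mul ![interp M a, interp M b] := by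
  have ha := Nat.left_le_pair a b
  have hb := Nat.right_le_pair a b
  rw [interp, interpStep, if_neg (by simp [mulN]), if_neg (by simp [mulN]),
    if_neg (by simp [mulN]), if_pos (by simp [mulN])]
  have h : (mulN a b - 1) / 4 = Nat.pair a b := by simp only [mulN]; omega
  rw [h, Nat.unpair_pair, if_pos (by simp only [mulN]; omega), if_pos (by simp only [mulN]; omega)]

theorem interp_witN (c l : List ℕ) : interp M (witN c l) = witness c (l.map (interp M)) := by
  rw [interp, interpStep, if_neg (by simp [witN]), if_neg (by simp [witN]),
    if_neg (by simp [witN]), if_neg (by simp [witN])]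
  have h : (witN c l - 1) / 4 = Encodable.encode (c, l) := by simp only [witN]; omega
  rw [h, Encodable.encodek, Option.map_some, Option.getD_some]
  refine congrArg _ (List.map_congr_left fun a ha => if_pos ?_)
  have h₁ := lt_encode_of_mem ha
  have h₂ : Encodable.encode l ≤ Encodable.encode (c, l) := Nat.right_le_pair _ _
  simp only [witN] at h₁ ⊢
  omega

theorem funMap_interp {n : ℕ} (f : LA.Functions n) (v : Fin n → ℕ) :
    Structure.funMap f (fun i => interp M (v i)) = interp M (nameStructure.funMap f v) := by
  rcases f with _ | _ | _ | _
  · exact (congrArg _ (Subsingleton.elim _ _)).trans interp_zero.symm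
  · refine (congrArg _ ?_).trans (interp_succN (v 0)).symm
    ext i
    fin_cases i
    rfl
  · exact (funMap_two _ _).trans (interp_addN (v 0) (v 1)).symm
  · exact (funMap_two _ _).trans (interp_mulN (v 0) (v 1)).symm

theorem exists_sat_of_model {A : List (List ℕ)}
    (hA : ∀ φ : LA.Sentence, formCode φ ∈ A → M ⊨ φ) :
    ∃ W : ℕ → Prop, ∀ x, Clause (A, x) → Sat W x := by
  refine ⟨diagram (interp M), fun x hx => sat_diagram funMap_interp (fun k φ v h => ?_) hA hx⟩
  refine realize_all_of_witness ?_
  convert h using 1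
  ext i
  refine i.lastCases ?_ fun i => ?_
  · simp [interp_witN, List.map_ofFn, Function.comp_def]
  · simp

end Completeness

section TermModel

variable {A : List (List ℕ)} {W : ℕ → Prop}

/-- The equality of names according to a valuation. -/
def nameSetoid (hW : ∀ x, EqClause x → Sat W x) : Setoid ℕ where
  r a b := W (eqN a b)
  iseqv :=
    { refl a := by simpa [Sat] using hW ([], [eqN a a]) ⟨a, a, a, a, by simp⟩
      symm {a b} h := by simpa [Sat, h] using hW ([eqN a b], [eqN b a]) ⟨a, b, a, a, by simp⟩
      trans {a b c} h h' := by
        simpa [Sat, h, h'] using hW ([eqN a b, eqN b c], [eqN a c]) ⟨a, b, c, a, by simp⟩ }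

/-- The structure of names before identifying equal names. -/
@[reducible]
def namePrestructure (hW : ∀ x, EqClause x → Sat W x) : LA.Prestructure (nameSetoid hW) where
  toStructure :=
    { funMap := nameStructure.funMap
      RelMap := fun {_} r => match r with
        | ArithRel.le => fun v => W (leN (v 0) (v 1)) }
  fun_equiv {n f} x y h := by
    rcases f with _ | _ | _ | _
    · exact (nameSetoid hW).refl _
    · have h₀ : W (eqN (x 0) (y 0)) := h 0
      change W (eqN (succN (x 0)) (succN (y 0)))
      simpa [Sat, h₀] using hW ([eqN (x 0) (y 0)], [eqN (succN (x 0)) (succN (y 0))])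
        ⟨x 0, y 0, 0, 0, by simp⟩
    · have h₀ : W (eqN (x 0) (y 0)) := h 0
      have h₁ : W (eqN (x 1) (y 1)) := h 1
      change W (eqN (addN (x 0) (x 1)) (addN (y 0) (y 1)))
      simpa [Sat, h₀, h₁] using hW ([eqN (x 0) (y 0), eqN (x 1) (y 1)],
        [eqN (addN (x 0) (x 1)) (addN (y 0) (y 1))]) ⟨x 0, y 0, x 1, y 1, by simp⟩
    · have h₀ : W (eqN (x 0) (y 0)) := h 0
      have h₁ : W (eqN (x 1) (y 1)) := h 1
      change W (eqN (mulN (x 0) (x 1)) (mulN (y 0) (y 1)))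
      simpa [Sat, h₀, h₁] using hW ([eqN (x 0) (y 0), eqN (x 1) (y 1)],
        [eqN (mulN (x 0) (x 1)) (mulN (y 0) (y 1))]) ⟨x 0, y 0, x 1, y 1, by simp⟩
  rel_equiv {n r} x y h := by
    rcases r with ⟨⟩
    have mono {x y : Fin 2 → ℕ} (h₀ : W (eqN (x 0) (y 0))) (h₁ : W (eqN (x 1) (y 1)))
        (h : W (leN (x 0) (x 1))) : W (leN (y 0) (y 1)) := by
      have := hW ([eqN (x 0) (y 0), eqN (x 1) (y 1), leN (x 0) (x 1)], [leN (y 0) (y 1)])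
        ⟨x 0, y 0, x 1, y 1, by simp⟩
      simpa [Sat, h₀, h₁, h] using this
    exact propext ⟨mono (h 0) (h 1),
      mono ((nameSetoid hW).symm (h 0)) ((nameSetoid hW).symm (h 1))⟩

theorem exists_model_of_sat (hW : ∀ x, Clause (A, x) → Sat W x) :
    ∃ (M : Type) (_ : LA.Structure M), Nonempty M ∧
      ∀ φ : LA.Sentence, formCode φ ∈ A → M ⊨ φ := by
  have hE : ∀ x, EqClause x → Sat W x := fun x hx => hW x (.inl hx)
  let _ := namePrestructure hE
  let ν : ℕ → Quotient (nameSetoid hE) := fun a => ⟦a⟧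
  have hν : ∀ {n} (f : LA.Functions n) (v : Fin n → ℕ),
      Structure.funMap f (fun i => ν (v i)) = ν (nameStructure.funMap f v) :=
    funMap_quotient_mk' (nameSetoid hE)
  have eq_iff (a b : ℕ) : ν a = ν b ↔ W (eqN a b) := Quotient.eq
  have le_iff (a b : ℕ) : LeIn (ν a) (ν b) ↔ W (leN a b) := by
    have h := relMap_quotient_mk' (L := LA) (nameSetoid hE) ArithRel.le ![a, b]
    refine Iff.trans (iff_of_eq (congrArg (Structure.RelMap (L := LA) ArithRel.le)
      (funext fun i => ?_))) h
    fin_cases i <;> rfl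
  have atom {k : ℕ} (t s : LA.Term (Empty ⊕ Fin k)) (v : Fin k → ℕ) {x}
      (hx : ∀ a b, a = @Term.realize LA ℕ nameStructure _ (Sum.elim (fun e => Empty.elim e) v) t →
        b = @Term.realize LA ℕ nameStructure _ (Sum.elim (fun e => Empty.elim e) v) s →
        (x = ([form (eqC k (termCode t) (termCode s)) (List.ofFn v)], [eqN a b]) ∨
        x = ([eqN a b], [form (eqC k (termCode t) (termCode s)) (List.ofFn v)]) ∨
        x = ([form (leC k (termCode t) (termCode s)) (List.ofFn v)], [leN a b]) ∨
        x = ([leN a b], [form (leC k (termCode t) (termCode s)) (List.ofFn v)]))) : Sat W x :=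
    hW x (.inr (.inl ⟨termCode t, termCode s, List.ofFn v, _, _, nameVal_ofFn.2 ⟨t, rfl, rfl⟩,
      nameVal_ofFn.2 ⟨s, rfl, rfl⟩, by simpa using hx _ _ rfl rfl⟩))
  have prop {k : ℕ} (φ ψ : LA.BoundedFormula Empty k) (v : Fin k → ℕ) {x}
      (hx : x = ([form (formCode (⊥ : LA.BoundedFormula Empty k)) (List.ofFn v)], []) ∨
        x = ([], [form (formCode (φ ⟹ ψ)) (List.ofFn v), form (formCode φ) (List.ofFn v)]) ∨
        x = ([form (formCode ψ) (List.ofFn v)], [form (formCode (φ ⟹ ψ)) (List.ofFn v)]) ∨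
        x = ([form (formCode (φ ⟹ ψ)) (List.ofFn v), form (formCode φ) (List.ofFn v)],
          [form (formCode ψ) (List.ofFn v)])) : Sat W x :=
    hW x (.inr (.inr (.inl ⟨formCode φ, formCode ψ, List.ofFn v,
      isFormCode_ofFn (j := 0).2 ⟨φ, rfl⟩, isFormCode_ofFn (j := 0).2 ⟨ψ, rfl⟩,
      by simpa [formCode_bot, formCode_imp] using hx⟩)))
  have quant {k : ℕ} (φ : LA.BoundedFormula Empty (k + 1)) (v : Fin k → ℕ) (a : ℕ) {x}
      (hx : x = ([form (formCode φ.all) (List.ofFn v)],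
          [form (formCode φ) (List.ofFn (Fin.snoc v a : Fin (k + 1) → ℕ))]) ∨
        x = ([form (formCode φ) (List.ofFn
          (Fin.snoc v (witN (formCode φ) (List.ofFn v)) : Fin (k + 1) → ℕ))],
          [form (formCode φ.all) (List.ofFn v)])) : Sat W x :=
    hW x (.inr (.inr (.inr (.inl ⟨formCode φ, List.ofFn v, a,
      isFormCode_ofFn (j := 1).2 ⟨φ, rfl⟩, by simpa only [formCode_all, ofFn_snoc] using hx⟩))))
  have snoc {k : ℕ} (v : Fin k → ℕ) (a : ℕ) :
      (Fin.snoc (fun i => ν (v i)) (ν a) : Fin (k + 1) → _) =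
        fun i => ν ((Fin.snoc v a : Fin (k + 1) → ℕ) i) := by
    ext i
    exact i.lastCases (by simp) (by simp)
  have truth {k : ℕ} (φ : LA.BoundedFormula Empty k) : ∀ v : Fin k → ℕ,
      φ.Realize (fun e => Empty.elim e) (fun i => ν (v i)) ↔
        W (form (formCode φ) (List.ofFn v)) := by
    refine form_induction (motive := fun k φ => ∀ v : Fin k → ℕ,
      φ.Realize (fun e => Empty.elim e) (fun i => ν (v i)) ↔
        W (form (formCode φ) (List.ofFn v))) (fun k v => ?_) (fun k t s v => ?_)
      (fun k t s v => ?_) (fun k φ ψ hφ hψ v => ?_) (fun k φ hφ v => ?_) φ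
    · have := prop ⊥ ⊥ v (.inl rfl)
      simpa [Sat] using this
    · rw [realize_bdEqual, formCode_equal, ← elim_comp, realize_comp_of_funMap hν,
        realize_comp_of_funMap hν, eq_iff]
      have h₁ := atom t s v fun a b ha hb => .inl (by rw [ha, hb])
      have h₂ := atom t s v fun a b ha hb => .inr (.inl (by rw [ha, hb]))
      simp only [Sat, List.mem_singleton, forall_eq, exists_eq_left] at h₁ h₂
      exact ⟨h₂, h₁⟩
    · rw [realize_leF, formCode_leF, ← elim_comp, realize_comp_of_funMap hν,
        realize_comp_of_funMap hν, le_iff]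
      have h₁ := atom t s v fun a b ha hb => .inr (.inr (.inl (by rw [ha, hb])))
      have h₂ := atom t s v fun a b ha hb => .inr (.inr (.inr (by rw [ha, hb])))
      simp only [Sat, List.mem_singleton, forall_eq, exists_eq_left] at h₁ h₂
      exact ⟨h₂, h₁⟩
    · rw [realize_imp, hφ, hψ]
      have h₁ := prop φ ψ v (.inr (.inl rfl))
      have h₂ := prop φ ψ v (.inr (.inr (.inl rfl)))
      have h₃ := prop φ ψ v (.inr (.inr (.inr rfl)))
      simp [Sat] at h₁ h₂ h₃
      tauto
    · rw [realize_all]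
      have h₁ a := quant φ v a (.inl rfl)
      have h₂ := quant φ v 0 (.inr rfl)
      simp only [Sat, List.mem_singleton, forall_eq, exists_eq_left] at h₁ h₂
      constructor
      · intro h
        refine h₂ ((hφ _).1 ?_)
        rw [← snoc]
        exact h _
      · intro h a
        induction a using Quotient.ind with
        | _ a =>
          have := (hφ _).2 (h₁ a h)
          rwa [← snoc] at this
  refine ⟨_, inferInstance, ⟨ν 0⟩, fun φ hφ => ?_⟩
  rw [realize_sentence φ (fun e => Empty.elim e) fun i => ν (![] i), truth φ ![] ]
  have := hW ([], [form (formCode φ) [] ]) (.inr (.inr (.inr (.inr ⟨formCode φ, hφ,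
    isFormCode_ofFn (v := ![]) (j := 0).2 ⟨φ, rfl⟩, rfl⟩))))
  simpa [Sat] using this

end TermModel

section Compactness

theorem isClosed_sat (x : List ℕ × List ℕ) :
    IsClosed {W : ℕ → Bool | Sat (fun p => W p = true) x} := by
  have h : {W : ℕ → Bool | Sat (fun p => W p = true) x} =
      (⋃ p ∈ {p | p ∈ x.1}, {W | W p = false}) ∪ ⋃ p ∈ {p | p ∈ x.2}, {W | W p = true} := by
    ext W
    simp only [Sat, Set.mem_ofPred_eq, Set.mem_union, Set.mem_iUnion, exists_prop,
      ← Bool.not_eq_true]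
    rw [imp_iff_not_or]
    push Not
    rfl
  rw [h]
  refine .union ?_ ?_ <;>
    exact (List.finite_toSet _).isClosed_biUnion fun p _ =>
      isClosed_eq (continuous_apply p) continuous_const

/-- A finite set of sequents without satisfying valuation. -/
def Contradictory (D : List (List ℕ × List ℕ)) : Prop :=
  ∃ N, ∀ s < 2 ^ N, ∃ x ∈ D, (∀ p ∈ x.1, s / 2 ^ p % 2 = 1) ∧ ∀ p ∈ x.2, p < N ∧ s / 2 ^ p % 2 = 0

@[fun_prop]
theorem sigmaPred_contradictory : SigmaPred 1 Contradictory := by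
  unfold Contradictory
  fun_prop

theorem contradictory_iff {D : List (List ℕ × List ℕ)} :
    Contradictory D ↔ ∀ W : ℕ → Bool, ∃ x ∈ D, ¬ Sat (fun p => W p = true) x := by
  simp only [Sat, not_forall, not_exists, not_and, exists_prop]
  constructor
  · rintro ⟨N, hN⟩ W
    have hs (p : ℕ) : (Nat.ofBits (fun i : Fin N => W i)) / 2 ^ p % 2 = 1 ↔ p < N ∧ W p = true := by
      rw [← decide_eq_true_iff (p := _ = 1), ← Nat.testBit_eq_decide_div_mod_eq]
      by_cases hp : p < N <;> simp [hp, Nat.testBit_ofBits]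
    obtain ⟨x, hx, h₁, h₂⟩ := hN (Nat.ofBits fun i : Fin N => W i) (Nat.ofBits_lt_two_pow _)
    refine ⟨x, hx, fun p hp => ((hs p).1 (h₁ p hp)).2, fun p hp h => ?_⟩
    have := (hs p).2 ⟨(h₂ p hp).1, h⟩
    have := (h₂ p hp).2
    omega
  · intro h
    obtain ⟨N, hN⟩ : ∃ N, ∀ x ∈ D, ∀ p ∈ x.2, p < N := by
      refine ⟨(D.flatMap Prod.snd).sum + 1, fun x hx p hp => Nat.lt_succ_iff.2 ?_⟩
      exact List.le_sum_of_mem (List.mem_flatMap.2 ⟨x, hx, hp⟩)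
    refine ⟨N, fun s _ => ?_⟩
    obtain ⟨x, hx, h₁, h₂⟩ := h fun p => decide (s / 2 ^ p % 2 = 1)
    refine ⟨x, hx, fun p hp => by simpa using h₁ p hp, fun p hp => ⟨hN x hx p hp, ?_⟩⟩
    simpa using h₂ p hp

/-- `A` codes a list of sentences without model. -/
def Unsat (A : List (List ℕ)) : Prop :=
  ∃ D : List (List ℕ × List ℕ), (∀ x ∈ D, Clause (A, x)) ∧ Contradictory D

@[fun_prop]
theorem sigmaPred_unsat : SigmaPred 1 Unsat := by
  unfold Unsat
  fun_prop

theorem unsat_iff {A : List (List ℕ)} :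
    Unsat A ↔ ∀ (M : Type) [LA.Structure M] [Nonempty M],
      ¬ ∀ φ : LA.Sentence, formCode φ ∈ A → M ⊨ φ := by
  constructor
  · rintro ⟨D, hD, hD'⟩ M _ _ hM
    inhabit M
    obtain ⟨W, hW⟩ := exists_sat_of_model hM
    classical
    obtain ⟨x, hx, h⟩ := contradictory_iff.1 hD' fun p => decide (W p)
    exact h (by simpa using hW x (hD x hx))
  · intro h
    have hemp : (Set.univ ∩ ⋂ x : {x // Clause (A, x)},
        {W : ℕ → Bool | Sat (fun p => W p = true) x.1}) = ∅ := by
      refine Set.eq_empty_of_forall_notMem fun W hW => ?_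
      simp only [Set.univ_inter, Set.mem_iInter, Subtype.forall] at hW
      obtain ⟨M, _, _, hM⟩ := exists_model_of_sat hW
      exact h M hM
    obtain ⟨u, hu⟩ := isCompact_univ.elim_finite_subfamily_closed _
      (fun x : {x // Clause (A, x)} => isClosed_sat x.1) hemp
    refine ⟨u.toList.map Subtype.val, ?_, contradictory_iff.2 fun W => ?_⟩
    · simp +contextual
    · have := Set.eq_empty_iff_forall_notMem.1 hu W
      simpa using this

end Compactness

section Provability

/-- Numerals with an arbitrary supply of variables. -/
def numT {α : Type} : ℕ → LA.Term α
  | 0 => zeroT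
  | m + 1 => succT (numT m)

def numC (m : ℕ) : List ℕ := m.rec zeroC fun _ t => succC t

@[fun_prop]
theorem primrec_numC {α : Type} [Primcodable α] {f : α → ℕ} (hf : Primrec f) :
    Primrec fun a => numC (f a) := by
  have h : Primrec₂ fun (_ : ℕ) (t : List ℕ) => succC t := by
    unfold Primrec₂
    fun_prop
  exact (Primrec.nat_rec₁ zeroC h).comp hf

theorem termCode_numT {k : ℕ} (m : ℕ) :
    termCode (numT m : LA.Term (Empty ⊕ Fin k)) = numC m := by
  induction m with
  | zero => rfl
  | succ m ih => rw [numT, termCode_succT, ih]; rfl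

theorem realize_numT {M α β : Type} [LA.Structure M] (m : ℕ) (v : α → M) (w : β → M) :
    (numT m).realize v = (numT m).realize w := by
  induction m with
  | zero => exact congrArg (Structure.funMap (L := LA) ArithFunc.zero) (funext fun i => i.elim0)
  | succ m ih =>
    refine congrArg _ (funext fun i => ?_)
    fin_cases i
    exact ih

theorem realize_numT_nat {α : Type} (m : ℕ) (v : α → ℕ) : (numT m).realize v = m := by
  induction m with
  | zero => rfl
  | succ m ih => exact congrArg (· + 1) ih

theorem numeral_eq (m : ℕ) : numeral m = numT m := by
  induction m with
  | zero => rfl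
  | succ m ih => rw [numeral, ih]; rfl

theorem realize_subst1 {M : Type} [LA.Structure M] (ψ : LA.BoundedFormula Empty 1) (m : ℕ) :
    M ⊨ subst1 ψ m ↔ ψ.Realize (fun e => Empty.elim e)
      fun _ => (numT m : LA.Term Empty).realize fun e => (Empty.elim e : M) := by
  rw [subst1, numeral_eq, Sentence.Realize, Formula.Realize, BoundedFormula.realize_subst]
  change Formula.Realize _ _ ↔ _
  rw [BoundedFormula.realize_toFormula]
  refine iff_of_eq (congrArg₂ _ (Subsingleton.elim _ _) (funext fun i => ?_))
  exact realize_numT m _ _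

/-- The sentence `∀ x, x = m → ¬ ψ(x)`. -/
def notInst (ψ : LA.BoundedFormula Empty 1) (m : ℕ) : LA.Sentence :=
  ((&0 =' numT m) ⟹ ∼ψ).all

def notInstC (c : List ℕ) (m : ℕ) : List ℕ :=
  allC (impC (eqC 1 (varC 0) (numC m)) (notC 1 c))

@[fun_prop]
theorem primrec_notInstC {α : Type} [Primcodable α] {g : α → List ℕ} {f : α → ℕ} (hg : Primrec g)
    (hf : Primrec f) : Primrec fun a => notInstC (g a) (f a) := by
  unfold notInstC
  fun_prop

theorem formCode_notInst (ψ : LA.BoundedFormula Empty 1) (m : ℕ) :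
    formCode (notInst ψ m) = notInstC (formCode ψ) m := by
  rw [notInst, formCode_all, formCode_imp, formCode_not, formCode_equal, termCode_numT]
  rfl

theorem realize_notInst {M : Type} [LA.Structure M] (ψ : LA.BoundedFormula Empty 1) (m : ℕ) :
    M ⊨ notInst ψ m ↔ M ⊨ ∼(subst1 ψ m) := by
  rw [Sentence.realize_not, realize_subst1, realize_sentence _ (fun e => Empty.elim e) ![], notInst,
    realize_all]
  have h (a : M) : (Fin.snoc ![] a : Fin 1 → M) = fun _ => a := by
    ext i
    fin_cases i
    rfl
  simp only [realize_imp, realize_bdEqual, realize_not, h,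
    realize_numT m _ fun e => (Empty.elim e : M)]
  exact forall_eq

theorem proves_notInst {T : LA.Theory} {ψ : LA.BoundedFormula Empty 1} {m : ℕ} :
    Proves T (notInst ψ m) ↔ Proves T (∼(subst1 ψ m)) := by
  simp only [Proves, Theory.models_sentence_iff, realize_notInst]

theorem finite_qTheory : QTheory.Finite := by
  unfold QTheory
  exact Set.toFinite _

/-- The codes of the axioms of Robinson arithmetic. -/
noncomputable def qCodes : List (List ℕ) := finite_qTheory.toFinset.toList.map formCode

theorem formCode_mem_qCodes {φ : LA.Sentence} : formCode φ ∈ qCodes ↔ φ ∈ QTheory := by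
  simp [qCodes, formCode_inj]

/-- Provability of the second sentence from Robinson arithmetic with the first one added, in
terms of codes. -/
def ProvC (x : List ℕ × List ℕ) : Prop := Unsat (notC 0 x.2 :: x.1 :: qCodes)

@[fun_prop]
theorem sigmaPred_provC : SigmaPred 1 ProvC := by
  unfold ProvC
  fun_prop

theorem provC_iff {γ φ : LA.Sentence} :
    ProvC (formCode γ, formCode φ) ↔ Proves (insert γ QTheory) φ := by
  rw [ProvC, unsat_iff, Proves, Theory.models_sentence_iff]
  simp only [← formCode_not, List.mem_cons, formCode_inj, formCode_mem_qCodes]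
  constructor
  · intro h M
    by_contra hM
    refine h M fun ψ hψ => ?_
    rcases hψ with rfl | hψ
    · exact (Sentence.realize_not M).2 hM
    · exact Theory.realize_sentence_of_mem (insert γ QTheory) hψ
  · intro h M _ _ hM
    have : M ⊨ (insert γ QTheory : LA.Theory) := ⟨fun ψ hψ => hM ψ (.inr hψ)⟩
    exact (Sentence.realize_not M).1 (hM _ (.inl rfl)) (h (.of _ M))

/-- Failure of `n + 1`-consistency of Robinson arithmetic with the sentence coded by `c` added. -/
def NIncC (n : ℕ) (c : List ℕ) : Prop :=
  ∃ d, (IsClassCode (false, n, 1, d) ∧ ProvC (c, exC 0 d)) ∧ ¬ ∃ m, ¬ ProvC (c, notInstC d m)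

theorem sigmaPred_nIncC (n : ℕ) : SigmaPred 3 (NIncC n) := by
  have h₁ : SigmaPred 1 fun x : List ℕ × List ℕ =>
    IsClassCode (false, n, 1, x.2) ∧ ProvC (x.1, exC 0 x.2) := by fun_prop
  have h₂ : SigmaPred 1 fun x : (List ℕ × List ℕ) × ℕ => ProvC (x.1.1, notInstC x.1.2 x.2) := by
    fun_prop
  exact ((h₁.mono (by norm_num)).and h₂.not.ex.not).ex

theorem nIncC_iff {n : ℕ} {γ : LA.Sentence} :
    NIncC n (formCode γ) ↔ ¬ NCon (n + 1) (insert γ QTheory) := by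
  rw [NCon, not_not, NIncC]
  dsimp only [IsClassCode]
  constructor
  · rintro ⟨_, ⟨⟨ψ, rfl, hψ⟩, h₁⟩, h₂⟩
    push Not at h₂
    refine ⟨ψ, hψ, fun m => ?_, ?_⟩
    · rw [← proves_notInst, ← provC_iff, formCode_notInst]
      exact h₂ m
    · rw [← provC_iff, formCode_ex]
      exact h₁
  · rintro ⟨ψ, hψ, h₁, h₂⟩
    refine ⟨formCode ψ, ⟨⟨ψ, rfl, hψ⟩, ?_⟩, ?_⟩
    · rw [← formCode_ex, provC_iff]
      exact h₂
    · push Not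
      intro m
      rw [← formCode_notInst, provC_iff, proves_notInst]
      exact h₁ m

end Provability

section Diagonal

/-- The formula `∃ e, e = ⌜χ⌝ ∧ χ(x, e)`. -/
def diag (χ : LA.BoundedFormula Empty 2) : LA.BoundedFormula Empty 1 :=
  ((&1 =' numT (godel χ)) ⊓ χ).ex

def diagC (c : List ℕ) : List ℕ :=
  exC 1 (infC 2 (eqC 2 (varC 1) (numC (Encodable.encode c))) c)

@[fun_prop]
theorem primrec_diagC {α : Type} [Primcodable α] {g : α → List ℕ} (hg : Primrec g) :
    Primrec fun a => diagC (g a) := by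
  unfold diagC
  fun_prop

theorem godel_diag (χ : LA.BoundedFormula Empty 2) :
    godel (diag χ) = Encodable.encode (diagC (formCode χ)) := by
  rw [godel_eq, diag, formCode_ex, formCode_inf, formCode_equal, termCode_numT, godel_eq]
  rfl

theorem realize_diag (χ : LA.BoundedFormula Empty 2) (x : ℕ) :
    (diag χ).Realize (fun e => Empty.elim e) ![x] ↔
      χ.Realize (fun e => Empty.elim e) ![x, godel χ] := by
  have h (a : ℕ) : (Fin.snoc ![x] a : Fin 2 → ℕ) = ![x, a] := by
    ext i
    fin_cases i <;> rfl
  simp only [diag, realize_ex, realize_inf, realize_bdEqual, realize_numT_nat, h]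
  exact exists_eq_left

theorem exists_fixedPoint {n : ℕ} {B : ℕ × ℕ → Prop} (hB : SigmaPred (n + 1) B) :
    ∃ Ψ : LA.BoundedFormula Empty 1, IsSigma (n + 1) Ψ ∧
      ∀ x, Ψ.Realize (fun e => Empty.elim e) ![x] ↔ B (godel Ψ, x) := by
  have hp : SigmaPred (n + 1) fun z : ℕ => ∃ c : List ℕ, z.unpair.1 = Encodable.encode c ∧
    B (Encodable.encode (diagC c), z.unpair.2) := by fun_prop
  obtain ⟨χ, hχ, h⟩ := SigmaDef.ex (R := fun (v : Fin 2 → ℕ) z => Nat.pair (v 1) (v 0) = z ∧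
    ∃ c : List ℕ, z.unpair.1 = Encodable.encode c ∧ B (Encodable.encode (diagC c), z.unpair.2))
    ((SigmaDef.natPair (TermDef.var 1).lift (TermDef.var 0).lift .last).and (hp.sigmaDef .last))
  refine ⟨diag χ, .ex (.inf ((Delta0.equal _ _).isSigma_isPi _).1 hχ), fun x => ?_⟩
  rw [realize_diag, h, godel_diag]
  simp [godel_eq χ, Encodable.encode_inj]

end Diagonal

section Soundness

theorem realize_qTheory : ℕ ⊨ QTheory := by
  refine ⟨fun φ hφ => ?_⟩
  rcases hφ with rfl | rfl | rfl | rfl | rfl | rfl | rfl | rfl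
  · intro a
    exact Nat.succ_ne_zero a
  · intro a b
    exact Nat.succ.inj
  · intro a ha
    refine realize_ex.2 ⟨a - 1, ?_⟩
    exact (Nat.succ_pred_eq_of_ne_zero ha).symm
  · intro a
    exact Nat.add_zero a
  · intro a b
    exact Nat.add_succ a b
  · intro a
    exact Nat.mul_zero a
  · intro a b
    exact Nat.mul_succ a b
  · intro a b
    rw [realize_iff, realize_ex]
    exact le_iff_exists_add'.trans ⟨fun ⟨c, h⟩ => ⟨c, h.symm⟩, fun ⟨c, h⟩ => ⟨c, h.symm⟩⟩

theorem nCon_of_realize {T : LA.Theory} (hT : ℕ ⊨ T) (n : ℕ) : NCon (n + 1) T := by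
  rintro ⟨ψ, -, h₁, h₂⟩
  have h {φ : LA.Sentence} (hφ : Proves T φ) : ℕ ⊨ φ :=
    Theory.models_sentence_iff.1 hφ (.of T ℕ)
  obtain ⟨a, ha⟩ := realize_ex.1 ((realize_sentence _ (fun e => Empty.elim e) ![]).1 (h h₂))
  refine (Sentence.realize_not ℕ).1 (h (h₁ a)) ((realize_subst1 ψ a).2 ?_)
  convert ha using 1
  ext i
  fin_cases i
  exact realize_numT_nat _ _

end Soundness

/-- **Theorem 3.5** (non-constructivity of the `n`-consistency incompleteness
theorem).  For `n ≥ 3` there is no `∅⁽ⁿ⁾`-recursive partial function `f` such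
that whenever `Ψ(x)` is a `Σ_{n+1}`-formula for which `T_Ψ` is an
`n`-consistent extension of `Q`, `f(⌜Ψ⌝)` is defined and is the Gödel code of
a `Π_{n+1}`-sentence independent of `T_Ψ`.  (The oracle `∅⁽ⁿ⁾` is rendered as
the Turing-equivalent set of codes of true `Σₙ`-sentences.) -/
theorem nonconstructivity_of_nConsistency_incompleteness (n : ℕ) (hn : 3 ≤ n) :
    ¬ ∃ f : ℕ →. ℕ, RecursiveIn (SigmaTruth n) f ∧
      ∀ Ψ : LA.BoundedFormula Empty 1, IsSigma (n + 1) Ψ →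
        ExtendsQ (TheoryOf Ψ) → NCon n (TheoryOf Ψ) →
        ∃ γ : LA.Sentence, IsPi (n + 1) γ ∧
          ¬ Proves (TheoryOf Ψ) γ ∧ ¬ Proves (TheoryOf Ψ) (∼γ) ∧
          godel γ ∈ f (godel Ψ) := by
  rintro ⟨f, hf, H⟩
  obtain ⟨n, rfl⟩ : ∃ m, n = m + 1 := ⟨n - 1, by omega⟩
  have hgraph := hf.sigmaPred_graph (sigmaPred_sigmaTruth n)
  have hInc : SigmaPred (n + 1 + 1) (NIncC n) := (sigmaPred_nIncC n).mono (by omega)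
  have hCon : SigmaPred (n + 1 + 1) fun c => ¬ NIncC n c :=
    (sigmaPred_nIncC n).not_of_lt (by omega)
  have hForm : SigmaPred (n + 1 + 1) IsFormCode := sigmaPred_isFormCode.mono (by omega)
  have hB : SigmaPred (n + 1 + 1) fun x : ℕ × ℕ => (∃ c ∈ qCodes, x.2 = Encodable.encode c) ∨
      ∃ c : List ℕ, Encodable.encode c ∈ f x.1 ∧ IsFormCode (0, c) ∧
        (¬ NIncC n c ∧ x.2 = Encodable.encode c ∨
          NIncC n c ∧ x.2 = Encodable.encode (notC 0 c)) := by
    refine .or (by fun_prop) (.ex (.and (hgraph.comp (f := fun x : (ℕ × ℕ) × List ℕ =>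
      (x.1.1, Encodable.encode x.2)) (by fun_prop)) (.and (by fun_prop) (.or ?_ (by fun_prop)))))
    exact (hCon.comp Primrec.snd).and (by fun_prop)
  obtain ⟨Ψ, hΨ, hΨB⟩ := exists_fixedPoint hB
  have mem_iff (φ : LA.Sentence) : φ ∈ TheoryOf Ψ ↔ φ ∈ QTheory ∨
      ∃ γ : LA.Sentence, godel γ ∈ f (godel Ψ) ∧
        (NCon (n + 1) (insert γ QTheory) ∧ φ = γ ∨
          ¬ NCon (n + 1) (insert γ QTheory) ∧ φ = ∼γ) := by
    refine (hΨB (godel φ)).trans (or_congr ?_ ⟨?_, ?_⟩)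
    · simp only [godel_eq φ, Encodable.encode_inj, exists_eq_right', formCode_mem_qCodes]
    · rintro ⟨c, hcf, hc, h⟩
      obtain ⟨γ, rfl⟩ := isFormCode_ofFn (v := ![]) (j := 0).1 hc
      refine ⟨γ, by rwa [godel_eq γ], ?_⟩
      simpa only [nIncC_iff, not_not, godel_eq φ, Encodable.encode_inj, ← formCode_not,
        formCode_inj] using h
    · rintro ⟨γ, hγ, h⟩
      refine ⟨formCode γ, by rwa [← godel_eq γ], isFormCode_ofFn (v := ![]) (j := 0).2 ⟨γ, rfl⟩, ?_⟩
      simpa only [nIncC_iff, not_not, godel_eq φ, Encodable.encode_inj, ← formCode_not,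
        formCode_inj] using h
  have proves_of_mem {φ : LA.Sentence} (h : φ ∈ TheoryOf Ψ) : Proves (TheoryOf Ψ) φ :=
    Theory.models_sentence_of_mem h
  have hTcon : NCon (n + 1) (TheoryOf Ψ) := by
    by_cases hex : ∃ γ : LA.Sentence, godel γ ∈ f (godel Ψ)
    · obtain ⟨γ, hγ⟩ := hex
      have huniq {δ : LA.Sentence} (hδ : godel δ ∈ f (godel Ψ)) : δ = γ :=
        godel_injective (Part.mem_unique hδ hγ)
      by_cases hc : NCon (n + 1) (insert γ QTheory)
      · have : TheoryOf Ψ = insert γ QTheory := by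
          ext φ
          rw [mem_iff, Set.mem_insert_iff, or_comm]
          refine or_congr ⟨?_, fun h => ⟨γ, hγ, .inl ⟨hc, h⟩⟩⟩ Iff.rfl
          rintro ⟨δ, hδ, h⟩
          obtain rfl := huniq hδ
          tauto
        rwa [this]
      · refine nCon_of_realize ⟨fun φ hφ => ?_⟩ n
        rcases (mem_iff φ).1 hφ with hφ | ⟨δ, hδ, h⟩
        · exact realize_qTheory.realize_of_mem φ hφ
        · obtain rfl := huniq hδ
          obtain ⟨-, rfl⟩ := h.resolve_left fun h => hc h.1
          refine (Sentence.realize_not ℕ).2 fun hδ => hc (nCon_of_realize ⟨?_⟩ n)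
          rintro φ (rfl | hφ)
          · exact hδ
          · exact realize_qTheory.realize_of_mem φ hφ
    · refine nCon_of_realize ⟨fun φ hφ => ?_⟩ n
      rcases (mem_iff φ).1 hφ with hφ | ⟨δ, hδ, -⟩
      · exact realize_qTheory.realize_of_mem φ hφ
      · exact absurd ⟨δ, hδ⟩ hex
  obtain ⟨γ, -, h₁, h₂, hγ⟩ :=
    H Ψ hΨ (fun φ hφ => proves_of_mem ((mem_iff φ).2 (.inl hφ))) hTcon
  by_cases hc : NCon (n + 1) (insert γ QTheory)
  · exact h₁ (proves_of_mem ((mem_iff _).2 (.inr ⟨γ, hγ, .inl ⟨hc, rfl⟩⟩)))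
  · exact h₂ (proves_of_mem ((mem_iff _).2 (.inr ⟨γ, hγ, .inr ⟨hc, rfl⟩⟩)))

end GRNonRE
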